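/- arXiv:2409.11130 — 5 statements merged into one kernel-verified Lean document; each statement's English description precedes it below -/
import Mathlib

section
/- For every γ ∈ [0, 1] there exists a constant N = N(γ) > 0 such that for all t ∈ (0, 1] and all x, x̄, y ∈ 𝕋 one has |p_t(x,y) − p_t(x̄,y)| ≤ N d(x, x̄)^γ t^{−γ/2} (p_{2t}(x,y) + p_{2t}(x̄,y)). -/
open MeasureTheory Real Set ENNReal

noncomputable section

instance fact01 : Fact ((0:ℝ) < 1) := ⟨one_pos⟩

/-- The Gaussian heat kernel on `ℝ`: `p^ℝ_t(z) = (4πt)^(-1/2) exp(-z²/(4t))`. -/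
def gaussKer (t z : ℝ) : ℝ := (4 * π * t) ^ (-(1:ℝ)/2) * Real.exp (-(z ^ 2) / (4 * t))

/-- The periodized heat kernel, as a (1-periodic) function of a real representative:
`a ↦ ∑_{k ∈ ℤ} p^ℝ_t(a + k)`. -/
def perKer (t a : ℝ) : ℝ := ∑' k : ℤ, gaussKer t (a + (k : ℝ))

/-- The heat kernel on the torus `𝕋 = ℝ/ℤ`:
`p_t(x,y) = ∑_{k ∈ ℤ} p^ℝ_t(x - y + k)`, defined via the representative of `x - y` in `[0,1)`. -/
def heatKer (t : ℝ) (x y : UnitAddCircle) : ℝ :=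
  AddCircle.liftIco 1 0 (perKer t) (x - y)

theorem exp_div_eq_sq {t : ℝ} (ht : 0 < t) (c : ℝ) :
    Real.exp (-(c ^ 2) / (4 * t)) = Real.exp (-(c ^ 2) / (4 * (2 * t))) ^ 2 := by
  rw [← Real.exp_nat_mul]
  congr 1
  push_cast
  field_simp

theorem exp_sub_exp_le_min {t : ℝ} (ht : 0 < t) {a b : ℝ} (hab : |b| ≤ |a|) :
    |Real.exp (-(a ^ 2) / (4 * t)) - Real.exp (-(b ^ 2) / (4 * t))| ≤
      min 1 (|a - b| / √t) * Real.exp (-(b ^ 2) / (4 * (2 * t))) := by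
  set E := Real.exp (-(b ^ 2) / (4 * (2 * t))) with hE
  have hE0 : 0 < E := Real.exp_pos _
  have hE1 : E ≤ 1 := Real.exp_le_one_iff.2 (by
    apply div_nonpos_of_nonpos_of_nonneg <;> nlinarith [sq_nonneg b])
  have hsq : b ^ 2 ≤ a ^ 2 := sq_le_sq.2 hab
  have hle : Real.exp (-(a ^ 2) / (4 * t)) ≤ Real.exp (-(b ^ 2) / (4 * t)) := by
    gcongr
  rw [abs_sub_comm, abs_of_nonneg (sub_nonneg.2 hle)]
  have ha0 := Real.exp_pos (-(a ^ 2) / (4 * t))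
  have hb2 : Real.exp (-(b ^ 2) / (4 * t)) = E ^ 2 := exp_div_eq_sq ht b
  rcases le_total 1 (|a - b| / √t) with h | h
  · rw [min_eq_left h, hb2]
    nlinarith
  · rw [min_eq_right h]
    set r := √t with hr
    have hr0 : 0 < r := Real.sqrt_pos.2 ht
    have hrt : t = r ^ 2 := (Real.sq_sqrt ht.le).symm
    set δ := |a - b| / r with hδ
    have hδ0 : 0 ≤ δ := by positivity
    set s := |b| / r with hs
    have hs0 : 0 ≤ s := by positivity
    have hd : |a| - |b| ≤ δ * r := by
      rw [hδ, div_mul_cancel₀ _ hr0.ne']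
      exact abs_sub_abs_le_abs_sub a b
    have hbs : |b| = s * r := by rw [hs, div_mul_cancel₀ _ hr0.ne']
    have hratio : Real.exp (-(a ^ 2) / (4 * t)) =
        E ^ 2 * Real.exp (-((a ^ 2 - b ^ 2) / (4 * t))) := by
      rw [← hb2, ← Real.exp_add]
      congr 1
      ring
    have hlin := Real.add_one_le_exp (-((a ^ 2 - b ^ 2) / (4 * t)))
    have hquot : (a ^ 2 - b ^ 2) / (4 * t) ≤ δ * (2 * s + 1) / 4 := by
      rw [div_le_iff₀ (by positivity), hrt, ← sq_abs a, ← sq_abs b, hbs]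
      have hA : |a| ≤ (δ + s) * r := by linarith
      have hA2 : |a| ^ 2 ≤ ((δ + s) * r) ^ 2 := by gcongr
      nlinarith [mul_nonneg (mul_nonneg hδ0 (sub_nonneg.2 h)) (sq_nonneg r)]
    have hEs : (2 * s + 1) / 4 * E ≤ 1 := by
      have h1 : E = (Real.exp (s ^ 2 / 8))⁻¹ := by
        rw [hE, ← Real.exp_neg, ← sq_abs b, hbs, hrt]
        congr 1
        field_simp
        ring
      rw [h1, ← div_eq_mul_inv, div_le_one (Real.exp_pos _)]
      nlinarith [Real.add_one_le_exp (s ^ 2 / 8), sq_nonneg (s - 2)]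
    have h2 : E ^ 2 * (1 - δ * (2 * s + 1) / 4) ≤ Real.exp (-(a ^ 2) / (4 * t)) := by
      rw [hratio]
      gcongr
      linarith
    rw [hb2]
    nlinarith [mul_le_mul_of_nonneg_left hEs (mul_nonneg hδ0 hE0.le)]

theorem abs_exp_sub_exp_le {t : ℝ} (ht : 0 < t) (a b : ℝ) :
    |Real.exp (-(a ^ 2) / (4 * t)) - Real.exp (-(b ^ 2) / (4 * t))| ≤
      min 1 (|a - b| / √t) *
        (Real.exp (-(a ^ 2) / (4 * (2 * t))) + Real.exp (-(b ^ 2) / (4 * (2 * t)))) := by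
  have hm : 0 ≤ min 1 (|a - b| / √t) := by positivity
  rcases le_total |b| |a| with h | h
  · refine (exp_sub_exp_le_min ht h).trans (mul_le_mul_of_nonneg_left ?_ hm)
    linarith [Real.exp_pos (-(a ^ 2) / (4 * (2 * t)))]
  · rw [abs_sub_comm, abs_sub_comm a b] at *
    refine (exp_sub_exp_le_min ht h).trans (mul_le_mul_of_nonneg_left ?_ hm)
    linarith [Real.exp_pos (-(b ^ 2) / (4 * (2 * t)))]

theorem abs_gaussKer_sub_le {t : ℝ} (ht : 0 < t) (a b : ℝ) :
    |gaussKer t a - gaussKer t b| ≤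
      √2 * min 1 (|a - b| / √t) * (gaussKer (2 * t) a + gaussKer (2 * t) b) := by
  have hpre : (4 * π * t) ^ (-(1:ℝ)/2) = √2 * (4 * π * (2 * t)) ^ (-(1:ℝ)/2) := by
    have h4 : (0:ℝ) ≤ 4 * π * t := by positivity
    rw [show 4 * π * (2 * t) = 2 * (4 * π * t) by ring,
      Real.mul_rpow zero_le_two h4, Real.sqrt_eq_rpow, ← mul_assoc,
      ← Real.rpow_add zero_lt_two]
    norm_num
  have hpos : 0 ≤ √2 * (4 * π * (2 * t)) ^ (-(1:ℝ)/2) := by positivity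
  have h := mul_le_mul_of_nonneg_left (abs_exp_sub_exp_le ht a b) hpos
  unfold gaussKer
  rw [← mul_sub, hpre, abs_mul, abs_of_nonneg hpos]
  refine h.trans_eq ?_
  ring

theorem summable_gaussKer {t : ℝ} (ht : 0 < t) (a : ℝ) :
    Summable fun k : ℤ => gaussKer t (a + (k : ℝ)) := by
  have h := HurwitzKernelBounds.summable_f_int 0 a (t := 1 / (4 * π * t)) (by positivity)
  refine (h.mul_left ((4 * π * t) ^ (-(1:ℝ)/2))).congr fun k => ?_
  simp only [HurwitzKernelBounds.f_int, gaussKer, pow_zero, one_mul]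
  congr 2
  have := Real.pi_pos.ne'
  field_simp
  ring

theorem perKer_add_int (t a : ℝ) (m : ℤ) : perKer t (a + m) = perKer t a := by
  unfold perKer
  rw [← (Equiv.addLeft m).tsum_eq fun k : ℤ => gaussKer t (a + (k : ℝ))]
  refine tsum_congr fun k => ?_
  simp [add_assoc]

theorem liftIco_perKer_coe (t a : ℝ) :
    AddCircle.liftIco 1 0 (perKer t) (a : UnitAddCircle) = perKer t a := by
  have hcoe : (a : UnitAddCircle) = ((Int.fract a : ℝ) : UnitAddCircle) := by
    rw [← sub_eq_zero, ← AddCircle.coe_sub, AddCircle.coe_eq_zero_iff]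
    exact ⟨⌊a⌋, by simp⟩
  rw [hcoe, AddCircle.liftIco_zero_coe_apply ⟨Int.fract_nonneg a, Int.fract_lt_one a⟩]
  conv_rhs => rw [← Int.fract_add_floor a, perKer_add_int]

theorem perKer_nonneg {t : ℝ} (ht : 0 < t) (a : ℝ) : 0 ≤ perKer t a :=
  tsum_nonneg fun k => by unfold gaussKer; positivity

theorem abs_perKer_sub_le {t : ℝ} (ht : 0 < t) (a b : ℝ) :
    |perKer t a - perKer t b| ≤
      √2 * min 1 (|a - b| / √t) * (perKer (2 * t) a + perKer (2 * t) b) := by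
  have h2 : 0 < 2 * t := by positivity
  unfold perKer
  rw [← (summable_gaussKer ht a).tsum_sub (summable_gaussKer ht b),
    ← (summable_gaussKer h2 a).tsum_add (summable_gaussKer h2 b), ← tsum_mul_left]
  refine tsum_of_norm_bounded (E := ℝ)
    (((summable_gaussKer h2 a).add (summable_gaussKer h2 b)).mul_left _).hasSum fun k => ?_
  simpa using abs_gaussKer_sub_le ht (a + (k : ℝ)) (b + (k : ℝ))

theorem min_one_div_sqrt_le {γ : ℝ} (hγ : γ ∈ Set.Icc (0:ℝ) 1) {t d : ℝ} (ht : 0 < t)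
    (hd : 0 ≤ d) : min 1 (d / √t) ≤ d ^ γ * t ^ (-γ/2) := by
  have hr : 0 < √t := Real.sqrt_pos.2 ht
  have hδ : 0 ≤ d / √t := by positivity
  have heq : d ^ γ * t ^ (-γ/2) = (d / √t) ^ γ := by
    rw [Real.div_rpow hd hr.le, Real.sqrt_eq_rpow, ← Real.rpow_mul ht.le,
      div_eq_mul_inv (d ^ γ), ← Real.rpow_neg ht.le]
    congr 2
    ring
  rw [heq]
  rcases le_total 1 (d / √t) with h | h
  · exact (min_le_left _ _).trans (Real.one_le_rpow h hγ.1)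
  · refine (min_le_right _ _).trans ?_
    simpa using Real.rpow_le_rpow_of_exponent_ge' hδ h hγ.1 hγ.2

theorem UnitAddCircle.exists_coe_eq_norm_eq (z : UnitAddCircle) :
    ∃ r : ℝ, (r : UnitAddCircle) = z ∧ ‖z‖ = |r| := by
  induction z using QuotientAddGroup.induction_on with
  | H u =>
    refine ⟨u - round u, ?_, UnitAddCircle.norm_eq⟩
    rw [← sub_eq_zero]
    refine (AddCircle.coe_eq_zero_iff 1).2 ⟨-round u, ?_⟩
    simp

/-- For every `γ ∈ [0,1]` there is `N = N(γ) > 0` such that for all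
`t ∈ (0,1]` and `x, x̄, y ∈ 𝕋`:
`|p_t(x,y) − p_t(x̄,y)| ≤ N d(x,x̄)^γ t^(−γ/2) (p_{2t}(x,y) + p_{2t}(x̄,y))`. -/
theorem stmt1 (γ : ℝ) (hγ : γ ∈ Set.Icc (0:ℝ) 1) :
    ∃ N : ℝ, 0 < N ∧ ∀ t : ℝ, 0 < t → t ≤ 1 → ∀ x x' y : UnitAddCircle,
      |heatKer t x y - heatKer t x' y| ≤
        N * dist x x' ^ γ * t ^ (-γ/2) * (heatKer (2*t) x y + heatKer (2*t) x' y) := by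
  refine ⟨√2, by positivity, fun t ht _ x x' y => ?_⟩
  obtain ⟨b, hb, -⟩ := UnitAddCircle.exists_coe_eq_norm_eq (x' - y)
  obtain ⟨r, hr, hnorm⟩ := UnitAddCircle.exists_coe_eq_norm_eq (x - x')
  have ha : ((b + r : ℝ) : UnitAddCircle) = x - y := by
    rw [AddCircle.coe_add, hb, hr]
    abel
  have h2 : 0 < 2 * t := by positivity
  simp only [heatKer, ← ha, ← hb, liftIco_perKer_coe]
  refine (abs_perKer_sub_le ht (b + r) b).trans ?_
  rw [dist_eq_norm, hnorm, add_sub_cancel_left, mul_assoc √2 (|r| ^ γ)]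
  have := perKer_nonneg h2 (b + r)
  have := perKer_nonneg h2 b
  gcongr
  exact min_one_div_sqrt_le hγ ht (abs_nonneg r)
end
end

section
/- For all γ, β ∈ [0, 1] with γ ≤ β there exists a constant N = N(γ, β) > 0 such that for all 0 < s ≤ t ≤ 1, all x, x̄ ∈ 𝕋, and every g : 𝕋 → ℝ with ‖g‖_{C^γ} < ∞, one has |P_t g(x) − P_s g(x̄)| ≤ N ‖g‖_{C^γ} (d(x, x̄)^β + (t − s)^{β/2}) s^{(γ − β)/2}. -/
open MeasureTheory Real Set ENNReal

noncomputable section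

/-- The heat semigroup on the torus: `P_t g(x) = ∫_𝕋 p_t(x,y) g(y) dy`. -/
def Pheat (t : ℝ) (g : UnitAddCircle → ℝ) (x : UnitAddCircle) : ℝ :=
  ∫ y, heatKer t x y * g y

/-- Sup-norm of a function on the torus. -/
def supNormT (g : UnitAddCircle → ℝ) : ℝ := ⨆ x, |g x|

/-- Hölder seminorm `[g]_{C^γ} = sup_{x ≠ y} |g(x) − g(y)| / d(x,y)^γ` on the torus. -/
def holderSemi (γ : ℝ) (g : UnitAddCircle → ℝ) : ℝ :=
  ⨆ q : {q : UnitAddCircle × UnitAddCircle // q.1 ≠ q.2},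
    |g q.1.1 - g q.1.2| / dist q.1.1 q.1.2 ^ γ

/-- Hölder norm `‖g‖_{C^γ}`: for `γ = 0` just the sup-norm, otherwise sup-norm plus
the `γ`-Hölder seminorm. -/
def holderNorm (γ : ℝ) (g : UnitAddCircle → ℝ) : ℝ :=
  if γ = 0 then supNormT g else supNormT g + holderSemi γ g

lemma gaussKer_eq_mul_exp (t z : ℝ) :
    gaussKer t z = (4 * π * t) ^ (-(1:ℝ)/2) * Real.exp (-(1 / (4 * t)) * z ^ 2) := by
  unfold gaussKer
  congr 2
  ring

lemma integrable_gaussKer {t : ℝ} (ht : 0 < t) : Integrable (gaussKer t) := by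
  have h : Integrable fun z : ℝ => (4 * π * t) ^ (-(1:ℝ)/2) * Real.exp (-(1 / (4 * t)) * z ^ 2) :=
    (integrable_exp_neg_mul_sq (by positivity)).const_mul _
  exact h.congr (.of_forall fun z => (gaussKer_eq_mul_exp t z).symm)

lemma integral_gaussKer {t : ℝ} (ht : 0 < t) : ∫ z, gaussKer t z = 1 := by
  have hpos : 0 < 4 * π * t := by positivity
  simp_rw [gaussKer_eq_mul_exp]
  rw [integral_const_mul, integral_gaussian, Real.sqrt_eq_rpow,
    show π / (1 / (4 * t)) = 4 * π * t by field_simp, ← Real.rpow_add hpos]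
  norm_num

lemma gaussKer_nonneg {t : ℝ} (ht : 0 < t) (z : ℝ) : 0 ≤ gaussKer t z := by
  unfold gaussKer
  positivity

lemma mul_gaussKer_mul {σ t : ℝ} (hσ : 0 < σ) (ht : 0 < t) (u : ℝ) :
    σ * gaussKer t (σ * u) = gaussKer (t / σ ^ 2) u := by
  unfold gaussKer
  have h1 : -(σ * u) ^ 2 / (4 * t) = -u ^ 2 / (4 * (t / σ ^ 2)) := by field_simp
  have h2 : (4 * π * (t / σ ^ 2)) ^ (-(1:ℝ)/2) = σ * (4 * π * t) ^ (-(1:ℝ)/2) := by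
    rw [← mul_div_assoc, Real.div_rpow (by positivity) (by positivity), ← Real.rpow_natCast,
      ← Real.rpow_mul hσ.le]
    norm_num
    rw [Real.rpow_neg_one]
    field_simp
  rw [h1, h2]
  ring

lemma perKer_add_intCast (t a : ℝ) (n : ℤ) : perKer t (a + n) = perKer t a := by
  unfold perKer
  rw [← (Equiv.addLeft n).tsum_eq (fun k : ℤ => gaussKer t (a + k))]
  refine tsum_congr fun k => ?_
  simp [add_assoc]

lemma heatKer_coe (t x y : ℝ) : heatKer t (x : UnitAddCircle) y = perKer t (x - y) := by
  have h : ((x : UnitAddCircle) - y) = ((Int.fract (x - y) : ℝ) : UnitAddCircle) := by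
    rw [← AddCircle.coe_sub, ← sub_eq_zero, ← AddCircle.coe_sub, Int.self_sub_fract,
      AddCircle.coe_eq_zero_iff]
    exact ⟨⌊x - y⌋, by simp⟩
  unfold heatKer
  rw [h, AddCircle.liftIco_zero_coe_apply ⟨Int.fract_nonneg _, Int.fract_lt_one _⟩]
  conv_rhs => rw [← Int.fract_add_floor (x - y), perKer_add_intCast]

lemma integrable_gaussKer_mul {t B : ℝ} (ht : 0 < t) {G : ℝ → ℝ} (hG : Measurable G)
    (hB : ∀ y, |G y| ≤ B) (x : ℝ) : Integrable fun y => gaussKer t (x - y) * G y := by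
  refine Integrable.mul_bdd (c := B) ((integrable_gaussKer ht).comp_sub_left x)
    hG.aestronglyMeasurable (.of_forall hB)

lemma Pheat_coe {t B : ℝ} (ht : 0 < t) {g : UnitAddCircle → ℝ} (hg : Measurable g)
    (hB : ∀ z, |g z| ≤ B) (x : ℝ) :
    Pheat t g x = ∫ y : ℝ, gaussKer t (x - y) * g y := by
  have hG : Measurable fun y : ℝ => g y := hg.comp AddCircle.measurable_mk'
  have hint := integrable_gaussKer_mul ht hG (fun y => hB y) x
  have hcoe : ∀ (y : ℝ) (n : ℤ), ((y + n : ℝ) : UnitAddCircle) = y := fun y n => by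
    rw [AddCircle.coe_add, add_eq_left, AddCircle.coe_eq_zero_iff]
    exact ⟨n, by simp⟩
  have hsum := hint.hasSum_intervalIntegral_comp_add_int
  have hsum_norm := hint.norm.hasSum_intervalIntegral_comp_add_int
  simp only [intervalIntegral.integral_of_le zero_le_one] at hsum hsum_norm
  have key := hasSum_integral_of_summable_integral_norm
    (μ := volume.restrict (Ioc (0:ℝ) 1))
    (F := fun (n : ℤ) (y : ℝ) => gaussKer t (x - (y + n)) * g ((y + n : ℝ) : UnitAddCircle))
    (fun n => (hint.comp_add_right (n : ℝ)).integrableOn) hsum_norm.summable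
  rw [hsum.unique key, Pheat, ← UnitAddCircle.integral_preimage 0, zero_add]
  refine setIntegral_congr_fun measurableSet_Ioc fun y _ => ?_
  simp only [hcoe, heatKer_coe, tsum_mul_right, perKer]
  congr 1
  rw [← (Equiv.neg ℤ).tsum_eq]
  refine tsum_congr fun k => ?_
  congr 1
  simp only [Equiv.neg_apply, Int.cast_neg]
  ring

lemma Pheat_coe_rescale {t σ B : ℝ} (ht : 0 < t) (hσ : 0 < σ) {g : UnitAddCircle → ℝ}
    (hg : Measurable g) (hB : ∀ z, |g z| ≤ B) (x x' : ℝ) :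
    Pheat t g x = ∫ w : ℝ, gaussKer (t / σ ^ 2) (w + (x - x') / σ) *
      g ((x' - σ * w : ℝ) : UnitAddCircle) := by
  have h : ∀ w : ℝ, gaussKer (t / σ ^ 2) (w + (x - x') / σ) * g ((x' - σ * w : ℝ) : UnitAddCircle)
      = σ * (gaussKer t (x - (x' - σ * w)) * g ((x' - σ * w : ℝ) : UnitAddCircle)) := fun w => by
    rw [← mul_gaussKer_mul hσ ht, show σ * (w + (x - x') / σ) = x - (x' - σ * w) by field_simp; ring,
      mul_assoc]
  rw [Pheat_coe ht hg hB]
  simp_rw [h]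
  rw [integral_const_mul, Measure.integral_comp_mul_left
      (fun v => gaussKer t (x - (x' - v)) * g ((x' - v : ℝ) : UnitAddCircle)),
    integral_sub_left_eq_self (fun y : ℝ => gaussKer t (x - y) * g (y : UnitAddCircle)),
    abs_of_pos (inv_pos.2 hσ), smul_eq_mul, mul_inv_cancel_left₀ hσ.ne']

lemma exists_coe_coe_abs_sub_eq_dist (x x' : UnitAddCircle) :
    ∃ a a' : ℝ, (a : UnitAddCircle) = x ∧ (a' : UnitAddCircle) = x' ∧ |a - a'| = dist x x' := by
  obtain ⟨b, rfl⟩ : ∃ b : ℝ, (b : UnitAddCircle) = x := QuotientAddGroup.mk_surjective x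
  obtain ⟨b', rfl⟩ : ∃ b : ℝ, (b : UnitAddCircle) = x' := QuotientAddGroup.mk_surjective x'
  refine ⟨b - round (b - b'), b', ?_, rfl, ?_⟩
  · rw [AddCircle.coe_sub, sub_eq_self, AddCircle.coe_eq_zero_iff]
    exact ⟨round (b - b'), by simp⟩
  · rw [dist_eq_norm, ← AddCircle.coe_sub, UnitAddCircle.norm_eq]
    ring_nf

lemma dist_coe_le (a b : ℝ) : dist (a : UnitAddCircle) (b : UnitAddCircle) ≤ |a - b| := by
  rw [dist_eq_norm, ← AddCircle.coe_sub, UnitAddCircle.norm_eq]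
  simpa using round_le (a - b) 0

lemma holderSemi_nonneg (γ : ℝ) (g : UnitAddCircle → ℝ) : 0 ≤ holderSemi γ g :=
  Real.iSup_nonneg fun _ => by positivity

lemma supNormT_nonneg (g : UnitAddCircle → ℝ) : 0 ≤ supNormT g :=
  Real.iSup_nonneg fun _ => abs_nonneg _

lemma holderNorm_nonneg (γ : ℝ) (g : UnitAddCircle → ℝ) : 0 ≤ holderNorm γ g := by
  unfold holderNorm
  split_ifs
  · exact supNormT_nonneg g
  · exact add_nonneg (supNormT_nonneg g) (holderSemi_nonneg γ g)

lemma abs_sub_le_holderNorm_mul_dist_rpow {γ : ℝ} {g : UnitAddCircle → ℝ}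
    (hb : BddAbove (Set.range fun z => |g z|))
    (hh : BddAbove (Set.range fun q : {q : UnitAddCircle × UnitAddCircle // q.1 ≠ q.2} =>
          |g q.1.1 - g q.1.2| / dist q.1.1 q.1.2 ^ γ)) (u v : UnitAddCircle) :
    |g u - g v| ≤ 2 * holderNorm γ g * dist u v ^ γ := by
  have hN := holderNorm_nonneg γ g
  rcases eq_or_ne u v with rfl | huv
  · rw [sub_self, abs_zero]
    positivity
  by_cases h0 : γ = 0
  · have h1 : |g u| ≤ supNormT g := le_ciSup hb u
    have h2 : |g v| ≤ supNormT g := le_ciSup hb v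
    simp only [holderNorm, h0, if_true, Real.rpow_zero]
    linarith [abs_sub (g u) (g v)]
  · have hd : 0 < dist u v ^ γ := Real.rpow_pos_of_pos (dist_pos.2 huv) _
    have h1 : |g u - g v| / dist u v ^ γ ≤ holderSemi γ g := le_ciSup hh ⟨(u, v), huv⟩
    rw [div_le_iff₀ hd] at h1
    have h2 : holderSemi γ g ≤ holderNorm γ g := by
      simpa [holderNorm, h0] using supNormT_nonneg g
    exact h1.trans (by gcongr; linarith)

lemma abs_coe_sub_coe_le {γ A : ℝ} (hγ : 0 ≤ γ) (hA : 0 ≤ A) {g : UnitAddCircle → ℝ}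
    (hg : ∀ u v, |g u - g v| ≤ A * dist u v ^ γ) (a b : ℝ) :
    |g (a : UnitAddCircle) - g (b : UnitAddCircle)| ≤ A * |a - b| ^ γ :=
  (hg _ _).trans (by gcongr; exact dist_coe_le a b)

/-- A common integrable majorant, dominating the Gaussian kernel and its increments against
weights of linear growth. -/
def gaussWeight (w : ℝ) : ℝ := (1 + w ^ 2) ^ 2 * Real.exp (-w ^ 2 / 16)

lemma gaussWeight_nonneg (w : ℝ) : 0 ≤ gaussWeight w := by
  unfold gaussWeight
  positivity

lemma integrable_gaussWeight : Integrable gaussWeight := by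
  have h (n : ℕ) : Integrable fun w : ℝ => w ^ n * Real.exp (-(1 / 16) * w ^ 2) := by
    simpa using integrable_rpow_mul_exp_neg_mul_sq (b := 1 / 16) (by norm_num) (s := n)
      (by linarith [n.cast_nonneg (α := ℝ)])
  refine (((h 0).add ((h 2).const_mul 2)).add (h 4)).congr (.of_forall fun w => ?_)
  simp only [gaussWeight, Pi.add_apply, show -w ^ 2 / 16 = -(1 / 16) * w ^ 2 by ring]
  ring

lemma rpow_le_two_mul_one_add_sq {γ a : ℝ} (h0 : 0 ≤ γ) (h1 : γ ≤ 1) (ha : 0 ≤ a) :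
    a ^ γ ≤ 2 * (1 + a ^ 2) := by
  have h : a ^ γ ≤ 1 + a := by
    rcases le_total a 1 with h | h
    · linarith [Real.rpow_le_one ha h h0]
    · have := Real.rpow_le_rpow_of_exponent_le h h1
      rw [Real.rpow_one] at this
      linarith
  nlinarith [sq_nonneg (a - 1)]

lemma four_pi_rpow_le_one : (4 * π) ^ (-(1:ℝ)/2) ≤ 1 :=
  Real.rpow_le_one_of_one_le_of_nonpos (by linarith [Real.pi_gt_three]) (by norm_num)

lemma gaussKer_one_le (w : ℝ) : gaussKer 1 w ≤ Real.exp (-w ^ 2 / 16) := by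
  unfold gaussKer
  rw [mul_one, mul_one]
  calc _ ≤ 1 * Real.exp (-w ^ 2 / 4) := by gcongr; exact four_pi_rpow_le_one
    _ ≤ _ := by
      rw [one_mul]
      exact Real.exp_le_exp.2 (by nlinarith [sq_nonneg w])

lemma abs_exp_neg_sub_exp_neg_le {a b m : ℝ} (ha : m ≤ a) (hb : m ≤ b) :
    |Real.exp (-a) - Real.exp (-b)| ≤ |a - b| * Real.exp (-m) := by
  wlog hab : a ≤ b generalizing a b
  · rw [abs_sub_comm, abs_sub_comm a]
    exact this hb ha (le_of_not_ge hab)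
  have h1 : Real.exp (-b) = Real.exp (-a) * Real.exp (-(b - a)) := by
    rw [← Real.exp_add]; ring_nf
  have h2 := Real.add_one_le_exp (-(b - a))
  have h3 : Real.exp (-a) ≤ Real.exp (-m) := by gcongr
  have h4 : Real.exp (-b) ≤ Real.exp (-a) := by gcongr
  rw [abs_of_nonneg (sub_nonneg.2 h4), abs_sub_comm, abs_of_nonneg (sub_nonneg.2 hab)]
  calc _ = Real.exp (-a) * (1 - Real.exp (-(b - a))) := by rw [h1]; ring
    _ ≤ Real.exp (-a) * (b - a) :=
        mul_le_mul_of_nonneg_left (by linarith) (Real.exp_pos _).le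
    _ ≤ Real.exp (-m) * (b - a) := mul_le_mul_of_nonneg_right h3 (sub_nonneg.2 hab)
    _ = _ := mul_comm _ _

lemma abs_gaussKer_sub_gaussKer_one_le {r η w : ℝ} (hr1 : 1 ≤ r) (hr2 : r ≤ 2) (hη : |η| ≤ 1) :
    |gaussKer r (w + η) - gaussKer 1 w| ≤
      4 * (|η| + (r - 1)) * ((1 + w ^ 2) * Real.exp (-w ^ 2 / 16)) := by
  have hr : 0 < r := by linarith
  set m : ℝ := w ^ 2 / 16 - 1 / 8 with hm
  set a : ℝ := (w + η) ^ 2 / (4 * r) with ha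
  set b : ℝ := w ^ 2 / 4 with hb
  have hη2 : η ^ 2 ≤ |η| := by
    rw [← sq_abs]; nlinarith [abs_nonneg η]
  have hma : m ≤ a := by
    have h1 : (w + η) ^ 2 / 8 ≤ a := by rw [ha]; gcongr; linarith
    have h2 : η ^ 2 ≤ 1 := hη2.trans hη
    nlinarith [sq_nonneg (w + 2 * η)]
  have hmb : m ≤ b := by rw [hm, hb]; nlinarith [sq_nonneg w]
  have hexp : Real.exp (-m) ≤ 2 * Real.exp (-w ^ 2 / 16) := by
    have h1 := Real.add_one_le_exp (-(1 / 8) : ℝ)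
    have h2 : Real.exp (1 / 8) * Real.exp (-(1 / 8)) = 1 := by rw [← Real.exp_add]; norm_num
    have h3 : Real.exp (1 / 8) ≤ 2 := by nlinarith [Real.exp_pos (1 / 8)]
    rw [show -m = 1 / 8 + -w ^ 2 / 16 by rw [hm]; ring, Real.exp_add]
    gcongr
  have hrinv : 1 - r⁻¹ ≤ r - 1 := by
    have : r * r⁻¹ = 1 := mul_inv_cancel₀ hr.ne'
    nlinarith [inv_pos.2 hr, sq_nonneg (r - 1)]
  have hrinv0 : r⁻¹ ≤ 1 := inv_le_one_of_one_le₀ hr1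
  have hrpow0 : r ^ (-(1:ℝ)/2) ≤ 1 := Real.rpow_le_one_of_one_le_of_nonpos hr1 (by norm_num)
  have hrpow : |r ^ (-(1:ℝ)/2) - 1| ≤ r - 1 := by
    have h1 : r⁻¹ ≤ r ^ (-(1:ℝ)/2) := by
      rw [← Real.rpow_neg_one]
      exact Real.rpow_le_rpow_of_exponent_le hr1 (by norm_num)
    rw [abs_sub_comm, abs_of_nonneg (by linarith)]
    linarith
  have hab : |a - b| ≤ (|η| + (r - 1)) * (1 + w ^ 2) := by
    have h1 : a - b = r⁻¹ * ((2 * w * η + η ^ 2) / 4) - w ^ 2 / 4 * (1 - r⁻¹) := by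
      rw [ha, hb]; field_simp; ring
    have h2 : |(2 * w * η + η ^ 2) / 4| ≤ |η| * (1 + w ^ 2) := by
      rw [abs_div, abs_of_pos (by norm_num : (0:ℝ) < 4), div_le_iff₀ (by norm_num)]
      refine (abs_add_le _ _).trans ?_
      rw [abs_mul, abs_mul, abs_two, abs_of_nonneg (sq_nonneg η), ← sq_abs w]
      nlinarith [abs_nonneg η, mul_nonneg (abs_nonneg η) (sq_nonneg (|w| - 1)),
        mul_nonneg (abs_nonneg η) (sq_nonneg (|w|))]
    have h3 : |r⁻¹ * ((2 * w * η + η ^ 2) / 4)| ≤ |η| * (1 + w ^ 2) := by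
      rw [abs_mul, abs_of_pos (inv_pos.2 hr)]
      exact (mul_le_of_le_one_left (abs_nonneg _) hrinv0).trans h2
    have h4 : |w ^ 2 / 4 * (1 - r⁻¹)| ≤ (r - 1) * (1 + w ^ 2) := by
      rw [abs_of_nonneg (mul_nonneg (by positivity) (by linarith))]
      nlinarith [sq_nonneg w, mul_le_mul_of_nonneg_left hrinv (sq_nonneg w)]
    rw [h1]
    refine (abs_sub _ _).trans ?_
    linarith
  have hdecomp : gaussKer r (w + η) - gaussKer 1 w = (4 * π) ^ (-(1:ℝ)/2) *
      ((r ^ (-(1:ℝ)/2) - 1) * Real.exp (-a) + (Real.exp (-a) - Real.exp (-b))) := by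
    unfold gaussKer
    rw [Real.mul_rpow (by positivity) hr.le, ha, hb, mul_one, mul_one,
      neg_div _ ((w + η) ^ 2), neg_div _ (w ^ 2)]
    ring
  have hδ : 0 ≤ |η| + (r - 1) := by linarith [abs_nonneg η]
  rw [hdecomp, abs_mul, abs_of_pos (by positivity)]
  calc _ ≤ 1 * (|(r ^ (-(1:ℝ)/2) - 1) * Real.exp (-a)| + |Real.exp (-a) - Real.exp (-b)|) := by
        gcongr
        · exact four_pi_rpow_le_one
        · exact abs_add_le _ _
    _ ≤ 1 * ((r - 1) * Real.exp (-m) + (|η| + (r - 1)) * (1 + w ^ 2) * Real.exp (-m)) := by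
        rw [abs_mul, Real.abs_exp]
        gcongr
        exact (abs_exp_neg_sub_exp_neg_le hma hmb).trans (by gcongr)
    _ ≤ 2 * ((|η| + (r - 1)) * (1 + w ^ 2)) * Real.exp (-m) := by
        have : r - 1 ≤ (|η| + (r - 1)) * (1 + w ^ 2) := by
          nlinarith [abs_nonneg η, mul_nonneg hδ (sq_nonneg w)]
        nlinarith [mul_le_mul_of_nonneg_right this (Real.exp_pos (-m)).le]
    _ ≤ 2 * ((|η| + (r - 1)) * (1 + w ^ 2)) * (2 * Real.exp (-w ^ 2 / 16)) := by gcongr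
    _ = _ := by ring

lemma abs_Pheat_sub_le_of_far {γ A B s t : ℝ} (hγ0 : 0 ≤ γ) (hγ1 : γ ≤ 1) (hA : 0 ≤ A)
    (hs : 0 < s) (hst : s ≤ t) {g : UnitAddCircle → ℝ} (hg : Measurable g)
    (hB : ∀ z, |g z| ≤ B) (hH : ∀ u v, |g u - g v| ≤ A * dist u v ^ γ) (a a' : ℝ) :
    |Pheat t g a - Pheat s g a'| ≤
      2 * A * (|a - a'| ^ γ + (t - s) ^ (γ / 2)) * ∫ w, gaussWeight w := by
  have ht : 0 < t := hs.trans_le hst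
  have hrep : ∀ {τ : ℝ}, 0 < τ → ∀ x : ℝ, Pheat τ g x =
      ∫ w : ℝ, gaussKer 1 w * g ((x - √τ * w : ℝ) : UnitAddCircle) := fun {τ} hτ x => by
    rw [Pheat_coe_rescale hτ (Real.sqrt_pos.2 hτ) hg hB x x]
    simp [Real.sq_sqrt hτ.le, div_self hτ.ne']
  have hint : ∀ τ x : ℝ, Integrable fun w : ℝ =>
      gaussKer 1 w * g ((x - √τ * w : ℝ) : UnitAddCircle) := fun τ x =>
    Integrable.mul_bdd (c := B) (integrable_gaussKer one_pos)
      (hg.comp (AddCircle.measurable_mk'.comp (by fun_prop))).aestronglyMeasurable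
      (.of_forall fun w => hB _)
  have hts : √t - √s ≤ √(t - s) := by
    refine Real.le_sqrt_of_sq_le ?_
    have h := Real.sqrt_le_sqrt hst
    nlinarith [Real.sq_sqrt hs.le, Real.sq_sqrt ht.le, Real.sqrt_nonneg s]
  have hsub : 0 ≤ √t - √s := sub_nonneg.2 (Real.sqrt_le_sqrt hst)
  have hD : 0 ≤ |a - a'| ^ γ + (t - s) ^ (γ / 2) :=
    add_nonneg (by positivity) (Real.rpow_nonneg (by linarith) _)
  rw [hrep ht, hrep hs, ← integral_sub (hint t a) (hint s a'), ← integral_const_mul,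
    ← Real.norm_eq_abs]
  refine norm_integral_le_of_norm_le (integrable_gaussWeight.const_mul _) (.of_forall fun w => ?_)
  rw [← mul_sub, Real.norm_eq_abs, abs_mul, abs_of_nonneg (gaussKer_nonneg one_pos w)]
  have h1 : |(a - √t * w) - (a' - √s * w)| ≤ |a - a'| + √(t - s) * |w| := by
    rw [show (a - √t * w) - (a' - √s * w) = (a - a') - (√t - √s) * w by ring]
    refine (abs_sub _ _).trans ?_
    rw [abs_mul, abs_of_nonneg hsub]
    gcongr
  have h2 : |(a - √t * w) - (a' - √s * w)| ^ γ ≤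
      (|a - a'| ^ γ + (t - s) ^ (γ / 2)) * (2 * (1 + w ^ 2)) := by
    have h3 : √(t - s) ^ γ = (t - s) ^ (γ / 2) := by
      rw [Real.sqrt_eq_rpow, ← Real.rpow_mul (by linarith)]; ring_nf
    have h4 := rpow_le_two_mul_one_add_sq hγ0 hγ1 (abs_nonneg w)
    rw [sq_abs] at h4
    calc _ ≤ (|a - a'| + √(t - s) * |w|) ^ γ := by gcongr
      _ ≤ |a - a'| ^ γ + (√(t - s) * |w|) ^ γ :=
        Real.rpow_add_le_add_rpow (by positivity) (by positivity) hγ0 hγ1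
      _ = |a - a'| ^ γ + (t - s) ^ (γ / 2) * |w| ^ γ := by
        rw [Real.mul_rpow (by positivity) (by positivity), h3]
      _ ≤ |a - a'| ^ γ * (2 * (1 + w ^ 2)) + (t - s) ^ (γ / 2) * (2 * (1 + w ^ 2)) := by
        have := Real.rpow_nonneg (sub_nonneg.2 hst) (γ / 2)
        gcongr
        exact le_mul_of_one_le_right (by positivity) (by nlinarith [sq_nonneg w])
      _ = _ := by ring
  calc _ ≤ Real.exp (-w ^ 2 / 16) *
        (A * ((|a - a'| ^ γ + (t - s) ^ (γ / 2)) * (2 * (1 + w ^ 2)))) := by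
        gcongr
        · exact gaussKer_one_le w
        · exact (abs_coe_sub_coe_le hγ0 hA hH _ _).trans (by gcongr)
    _ = 2 * A * (|a - a'| ^ γ + (t - s) ^ (γ / 2)) * ((1 + w ^ 2) * Real.exp (-w ^ 2 / 16)) := by
        ring
    _ ≤ _ := by
        unfold gaussWeight
        gcongr
        exact le_self_pow₀ (by nlinarith [sq_nonneg w]) two_ne_zero

lemma abs_Pheat_sub_le_of_near {γ A B s t : ℝ} (hγ0 : 0 ≤ γ) (hγ1 : γ ≤ 1) (hA : 0 ≤ A)
    (hs : 0 < s) (hst : s ≤ t) (hts : t ≤ 2 * s) {g : UnitAddCircle → ℝ} (hg : Measurable g)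
    (hB : ∀ z, |g z| ≤ B) (hH : ∀ u v, |g u - g v| ≤ A * dist u v ^ γ) {a a' : ℝ}
    (haa : |a - a'| ≤ √s) :
    |Pheat t g a - Pheat s g a'| ≤
      8 * A * s ^ (γ / 2) * (|a - a'| / √s + (t - s) / s) * ∫ w, gaussWeight w := by
  have ht : 0 < t := hs.trans_le hst
  have hσ : 0 < √s := Real.sqrt_pos.2 hs
  set η := (a - a') / √s with hη
  have hηabs : |η| = |a - a'| / √s := by rw [hη, abs_div, abs_of_pos hσ]
  have hη1 : |η| ≤ 1 := by rwa [hηabs, div_le_one hσ]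
  have hr : (t - s) / s = t / s - 1 := by field_simp
  have hr1 : 1 ≤ t / s := by rwa [one_le_div hs]
  have hr2 : t / s ≤ 2 := by rwa [div_le_iff₀ hs]
  have hr0 : 0 < t / s := by positivity
  have hmeas : Measurable fun w : ℝ => g ((a' - √s * w : ℝ) : UnitAddCircle) :=
    hg.comp (AddCircle.measurable_mk'.comp (by fun_prop))
  have hK1 : Integrable fun w => gaussKer (t / s) (w + η) :=
    (integrable_gaussKer hr0).comp_add_right η
  have hK2 : Integrable (gaussKer 1) := integrable_gaussKer one_pos
  have hKint : ∫ w, (gaussKer (t / s) (w + η) - gaussKer 1 w) = 0 := by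
    rw [integral_sub hK1 hK2, integral_add_right_eq_self (gaussKer (t / s)),
      integral_gaussKer hr0, integral_gaussKer one_pos, sub_self]
  have hI1 := hK1.mul_bdd (c := B) hmeas.aestronglyMeasurable (.of_forall fun w => hB _)
  have hI2 := hK2.mul_bdd (c := B) hmeas.aestronglyMeasurable (.of_forall fun w => hB _)
  have hPt : Pheat t g a = ∫ w : ℝ, gaussKer (t / s) (w + η) *
      g ((a' - √s * w : ℝ) : UnitAddCircle) := by
    rw [Pheat_coe_rescale ht hσ hg hB a a', Real.sq_sqrt hs.le]
  have hPs : Pheat s g a' = ∫ w : ℝ, gaussKer 1 w * g ((a' - √s * w : ℝ) : UnitAddCircle) := by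
    rw [Pheat_coe_rescale hs hσ hg hB a' a', Real.sq_sqrt hs.le]
    simp [div_self hs.ne']
  have hdiff : Pheat t g a - Pheat s g a' = ∫ w : ℝ, (gaussKer (t / s) (w + η) - gaussKer 1 w) *
      (g ((a' - √s * w : ℝ) : UnitAddCircle) - g (a' : UnitAddCircle)) := by
    have h0 : ∫ w, (gaussKer (t / s) (w + η) - gaussKer 1 w) * g (a' : UnitAddCircle) = 0 := by
      rw [integral_mul_const, hKint, zero_mul]
    rw [hPt, hPs, ← integral_sub hI1 hI2, ← sub_zero (∫ w, _ ∂_), ← h0,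
      ← integral_sub (by exact hI1.sub hI2) (by exact (hK1.sub hK2).mul_const _)]
    congr 1 with w
    ring
  have hD : 0 ≤ |η| + (t / s - 1) := by linarith [abs_nonneg η]
  rw [hdiff, hr, ← hηabs, ← integral_const_mul, ← Real.norm_eq_abs]
  refine norm_integral_le_of_norm_le (integrable_gaussWeight.const_mul _) (.of_forall fun w => ?_)
  have hg' : |g ((a' - √s * w : ℝ) : UnitAddCircle) - g (a' : UnitAddCircle)| ≤
      A * (s ^ (γ / 2) * (2 * (1 + w ^ 2))) := by
    have h4 := rpow_le_two_mul_one_add_sq hγ0 hγ1 (abs_nonneg w)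
    rw [sq_abs] at h4
    have h3 : √s ^ γ = s ^ (γ / 2) := by
      rw [Real.sqrt_eq_rpow, ← Real.rpow_mul hs.le]; ring_nf
    refine (abs_coe_sub_coe_le hγ0 hA hH _ _).trans ?_
    rw [sub_sub_cancel_left, abs_neg, abs_mul, abs_of_pos hσ,
      Real.mul_rpow hσ.le (abs_nonneg w), h3]
    gcongr
  rw [Real.norm_eq_abs, abs_mul]
  calc _ ≤ (4 * (|η| + (t / s - 1)) * ((1 + w ^ 2) * Real.exp (-w ^ 2 / 16))) *
        (A * (s ^ (γ / 2) * (2 * (1 + w ^ 2)))) := by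
        gcongr
        exact abs_gaussKer_sub_gaussKer_one_le hr1 hr2 hη1
    _ = _ := by unfold gaussWeight; ring

lemma add_rpow_le_of_far {γ β s d τ : ℝ} (hγ : 0 ≤ γ) (hγβ : γ ≤ β) (hs : 0 < s) (hd : 0 ≤ d)
    (hτ : 0 ≤ τ) (h : √s < d ∨ s < τ) :
    d ^ γ + τ ^ (γ / 2) ≤ 2 * ((d ^ β + τ ^ (β / 2)) * s ^ ((γ - β) / 2)) := by
  have hsqrt : ∀ {x : ℝ}, 0 ≤ x → ∀ p : ℝ, √x ^ p = x ^ (p / 2) := fun {x} hx p => by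
    rw [Real.sqrt_eq_rpow, ← Real.rpow_mul hx]; ring_nf
  rw [← hsqrt hτ, ← hsqrt hτ, ← hsqrt hs.le]
  have hM : √s ≤ max d √τ := by
    rcases h with h | h
    · exact h.le.trans (le_max_left _ _)
    · exact (Real.sqrt_le_sqrt h.le).trans (le_max_right _ _)
  set M := max d √τ with hMdef
  have hσ : 0 < √s := Real.sqrt_pos.2 hs
  have hMpos : 0 < M := hσ.trans_le hM
  have h1 : d ^ γ ≤ M ^ γ := by gcongr; exact le_max_left _ _
  have h2 : √τ ^ γ ≤ M ^ γ := by gcongr; exact le_max_right _ _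
  have h3 : M ^ γ = M ^ β * M ^ (γ - β) := by rw [← Real.rpow_add hMpos]; ring_nf
  have h4 : M ^ (γ - β) ≤ √s ^ (γ - β) :=
    Real.rpow_le_rpow_of_nonpos hσ hM (by linarith)
  have h5 : M ^ β ≤ d ^ β + √τ ^ β := by
    have hd' : 0 ≤ d ^ β := by positivity
    have hτ' : 0 ≤ √τ ^ β := by positivity
    rcases max_choice d √τ with h | h <;> rw [hMdef, h] <;> linarith
  calc _ ≤ 2 * M ^ γ := by linarith
    _ = 2 * (M ^ β * M ^ (γ - β)) := by rw [h3]
    _ ≤ _ := by gcongr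

lemma rpow_mul_add_le_of_near {γ β s d τ : ℝ} (hβ0 : 0 ≤ β) (hβ1 : β ≤ 1) (hs : 0 < s)
    (hd : 0 ≤ d) (hτ : 0 ≤ τ) (hds : d ≤ √s) (hτs : τ ≤ s) :
    s ^ (γ / 2) * (d / √s + τ / s) ≤ (d ^ β + τ ^ (β / 2)) * s ^ ((γ - β) / 2) := by
  have hσ : 0 < √s := Real.sqrt_pos.2 hs
  have hle : ∀ {x p : ℝ}, 0 ≤ x → x ≤ 1 → 0 ≤ p → p ≤ 1 → x ≤ x ^ p := fun {x p} h0 h1 hp0 hp => by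
    simpa using Real.rpow_le_rpow_of_exponent_ge' h0 h1 hp0 hp
  have h1 : d / √s ≤ d ^ β / s ^ (β / 2) := by
    refine (hle (by positivity) ((div_le_one hσ).2 hds) hβ0 hβ1).trans_eq ?_
    rw [Real.div_rpow hd hσ.le, Real.sqrt_eq_rpow, ← Real.rpow_mul hs.le]
    ring_nf
  have h2 : τ / s ≤ τ ^ (β / 2) / s ^ (β / 2) := by
    rw [← Real.div_rpow hτ hs.le]
    exact hle (by positivity) ((div_le_one hs).2 hτs) (by linarith) (by linarith)
  rw [sub_div, Real.rpow_sub hs]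
  calc _ ≤ s ^ (γ / 2) * (d ^ β / s ^ (β / 2) + τ ^ (β / 2) / s ^ (β / 2)) := by gcongr
    _ = _ := by ring

/-- For all `γ, β ∈ [0,1]` with `γ ≤ β` there is `N = N(γ,β) > 0` such that
for all `0 < s ≤ t ≤ 1`, all `x, x̄ ∈ 𝕋` and every measurable `g : 𝕋 → ℝ` with
`‖g‖_{C^γ} < ∞` (i.e. with bounded values and bounded Hölder quotients):
`|P_t g(x) − P_s g(x̄)| ≤ N ‖g‖_{C^γ} (d(x,x̄)^β + (t−s)^(β/2)) s^((γ−β)/2)`. -/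
theorem stmt2 (γ β : ℝ) (hγ : γ ∈ Set.Icc (0:ℝ) 1) (hβ : β ∈ Set.Icc (0:ℝ) 1) (hγβ : γ ≤ β) :
    ∃ N : ℝ, 0 < N ∧ ∀ s t : ℝ, 0 < s → s ≤ t → t ≤ 1 → ∀ x x' : UnitAddCircle,
      ∀ g : UnitAddCircle → ℝ, Measurable g →
        BddAbove (Set.range fun z => |g z|) →
        BddAbove (Set.range fun q : {q : UnitAddCircle × UnitAddCircle // q.1 ≠ q.2} =>
          |g q.1.1 - g q.1.2| / dist q.1.1 q.1.2 ^ γ) →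
        |Pheat t g x - Pheat s g x'| ≤
          N * holderNorm γ g * (dist x x' ^ β + (t - s) ^ (β/2)) * s ^ ((γ - β)/2) := by
  have hI : 0 ≤ ∫ w, gaussWeight w := integral_nonneg gaussWeight_nonneg
  set I := ∫ w, gaussWeight w with hIdef
  refine ⟨16 * I + 1, by positivity, fun s t hs hst _ x x' g hg hb hh => ?_⟩
  obtain ⟨a, a', rfl, rfl, hd⟩ := exists_coe_coe_abs_sub_eq_dist x x'
  have hN := holderNorm_nonneg γ g
  have hH := abs_sub_le_holderNorm_mul_dist_rpow hb hh
  have hB : ∀ z, |g z| ≤ supNormT g := fun z => le_ciSup hb z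
  have hτ : 0 ≤ t - s := sub_nonneg.2 hst
  rw [← hd]
  set R := (|a - a'| ^ β + (t - s) ^ (β / 2)) * s ^ ((γ - β) / 2) with hR
  have hR0 : 0 ≤ R := mul_nonneg
    (add_nonneg (by positivity) (Real.rpow_nonneg hτ _)) (by positivity)
  suffices h : |Pheat t g a - Pheat s g a'| ≤ 16 * I * holderNorm γ g * R by
    refine h.trans ?_
    rw [mul_assoc ((16 * I + 1) * holderNorm γ g)]
    gcongr
    linarith
  by_cases hnear : |a - a'| ≤ √s ∧ t - s ≤ s
  · refine (abs_Pheat_sub_le_of_near hγ.1 hγ.2 (by positivity) hs hst (by linarith [hnear.2])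
      hg hB hH hnear.1).trans ?_
    have h := rpow_mul_add_le_of_near (γ := γ) hβ.1 hβ.2 hs (abs_nonneg (a - a')) hτ
      hnear.1 hnear.2
    calc _ = 16 * I * holderNorm γ g * (s ^ (γ / 2) * (|a - a'| / √s + (t - s) / s)) := by ring
      _ ≤ _ := by gcongr
  · have hfar : √s < |a - a'| ∨ s < t - s := by
      by_contra! h
      exact hnear h
    refine (abs_Pheat_sub_le_of_far hγ.1 hγ.2 (by positivity) hs hst hg hB hH a a').trans ?_
    have h := add_rpow_le_of_far hγ.1 hγβ hs (abs_nonneg (a - a')) hτ hfar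
    calc _ = 4 * I * holderNorm γ g * (|a - a'| ^ γ + (t - s) ^ (γ / 2)) := by ring
      _ ≤ 4 * I * holderNorm γ g * (2 * R) := by gcongr
      _ ≤ _ := by nlinarith [mul_nonneg (mul_nonneg hI hN) hR0]
end
end

section
/- Let f : ℝ → ℝ be twice continuously differentiable. Then for all φ₁, φ₂, φ₃, φ₄ ∈ ℝ one has f(φ₁) − f(φ₂) − f(φ₃) + f(φ₄) = ∫₀¹ ∫₀¹ (φ₁ − φ₂)(θ(φ₁ − φ₃) + (1 − θ)(φ₂ − φ₄)) · f''(Θ₁(θ, η)) dη dθ + (φ₁ − φ₂ − φ₃ + φ₄) ∫₀¹ f'(Θ₂(θ)) dθ, where Θ₁(θ, η) := η(θφ₁ + (1 − θ)φ₂) + (1 − η)(θφ₃ + (1 − θ)φ₄) and Θ₂(θ) := θφ₃ + (1 − θ)φ₄. -/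
open MeasureTheory intervalIntegral

/-- The fundamental theorem of calculus along the segment from `b` to `a`. -/
theorem sub_mul_integral_deriv_segment {g : ℝ → ℝ} (hg : ContDiff ℝ 1 g) (a b : ℝ) :
    (a - b) * ∫ t in (0:ℝ)..1, deriv g (t * a + (1 - t) * b) = g a - g b := by
  have hcont : Continuous (deriv g) := hg.continuous_deriv le_rfl
  have hderiv : ∀ t ∈ Set.uIcc (0:ℝ) 1, HasDerivAt (fun t => g (t * a + (1 - t) * b))
      ((a - b) * deriv g (t * a + (1 - t) * b)) t := by
    intro t _
    have hsegment : HasDerivAt (fun t : ℝ => t * a + (1 - t) * b) (a - b) t := by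
      simpa [sub_eq_add_neg] using ((hasDerivAt_id t).mul_const a).fun_add
        (((hasDerivAt_id t).const_sub 1).mul_const b)
    have hgt := ((hg.differentiable one_ne_zero) (t * a + (1 - t) * b)).hasDerivAt
    rw [mul_comm]
    exact hgt.comp t hsegment
  rw [← intervalIntegral.integral_const_mul, integral_eq_sub_of_hasDerivAt hderiv
    (Continuous.intervalIntegrable (by fun_prop) _ _)]
  simp

/-- Let `f : ℝ → ℝ` be twice continuously differentiable. Then for all
`φ₁, φ₂, φ₃, φ₄ ∈ ℝ`:
`f(φ₁) − f(φ₂) − f(φ₃) + f(φ₄)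
  = ∫₀¹ ∫₀¹ (φ₁ − φ₂)(θ(φ₁ − φ₃) + (1 − θ)(φ₂ − φ₄)) f''(Θ₁(θ,η)) dη dθ
    + (φ₁ − φ₂ − φ₃ + φ₄) ∫₀¹ f'(Θ₂(θ)) dθ`,
where `Θ₁(θ,η) = η(θφ₁ + (1−θ)φ₂) + (1−η)(θφ₃ + (1−θ)φ₄)` and `Θ₂(θ) = θφ₃ + (1−θ)φ₄`. -/
theorem stmt13 (f : ℝ → ℝ) (hf : ContDiff ℝ 2 f) (φ₁ φ₂ φ₃ φ₄ : ℝ) :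
    f φ₁ - f φ₂ - f φ₃ + f φ₄ =
      (∫ θ in (0:ℝ)..1, ∫ η in (0:ℝ)..1,
        (φ₁ - φ₂) * (θ * (φ₁ - φ₃) + (1 - θ) * (φ₂ - φ₄)) *
          deriv (deriv f) (η * (θ * φ₁ + (1 - θ) * φ₂) + (1 - η) * (θ * φ₃ + (1 - θ) * φ₄)))
      + (φ₁ - φ₂ - φ₃ + φ₄) * ∫ θ in (0:ℝ)..1, deriv f (θ * φ₃ + (1 - θ) * φ₄) := by
  have hf₁ : ContDiff ℝ 1 f := hf.of_le one_le_two
  have hderiv : ContDiff ℝ 1 (deriv f) :=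
    ((contDiff_succ_iff_deriv (n := 1)).1 hf).2.2
  have hcont : Continuous (deriv f) := hderiv.continuous
  have hinner (θ : ℝ) : (∫ η in (0:ℝ)..1,
        (φ₁ - φ₂) * (θ * (φ₁ - φ₃) + (1 - θ) * (φ₂ - φ₄)) *
          deriv (deriv f) (η * (θ * φ₁ + (1 - θ) * φ₂) + (1 - η) * (θ * φ₃ + (1 - θ) * φ₄))) =
      (φ₁ - φ₂) * (deriv f (θ * φ₁ + (1 - θ) * φ₂) - deriv f (θ * φ₃ + (1 - θ) * φ₄)) := by
    rw [intervalIntegral.integral_const_mul, ← sub_mul_integral_deriv_segment hderiv]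
    ring
  simp_rw [hinner]
  rw [intervalIntegral.integral_const_mul, intervalIntegral.integral_sub
    (Continuous.intervalIntegrable (by fun_prop) _ _)
    (Continuous.intervalIntegrable (by fun_prop) _ _)]
  linear_combination sub_mul_integral_deriv_segment hf₁ φ₃ φ₄ -
    sub_mul_integral_deriv_segment hf₁ φ₁ φ₂
end

section
/- Let f : ℝ → ℝ be twice differentiable with bounded first and second derivatives. Then for all φ₁, φ₂, φ₃, φ₄ ∈ ℝ one has |f(φ₁) − f(φ₂) − f(φ₃) + f(φ₄)| ≤ (sup_x |f''(x)|) · |φ₁ − φ₂| · |φ₁ − φ₃| + (sup_x |f'(x)|) · |φ₁ − φ₂ − φ₃ + φ₄|. -/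
/-- Mean value inequality for an everywhere differentiable real function. -/
theorem abs_sub_le_of_abs_deriv_le {g : ℝ → ℝ} {C : ℝ} (hg : ∀ x, DifferentiableAt ℝ g x)
    (hC : ∀ x, |deriv g x| ≤ C) (x y : ℝ) : |g y - g x| ≤ C * |y - x| :=
  convex_univ.norm_image_sub_le_of_norm_deriv_le (fun z _ => hg z) (fun z _ => hC z)
    (Set.mem_univ x) (Set.mem_univ y)

/-- A second difference is controlled by a bound on the second derivative. -/
theorem abs_second_difference_le {f : ℝ → ℝ} {C : ℝ} (hd1 : ∀ x, DifferentiableAt ℝ f x)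
    (hd2 : ∀ x, DifferentiableAt ℝ (deriv f) x) (hC : ∀ x, |deriv (deriv f) x| ≤ C)
    (x y k : ℝ) : |(f (y + k) - f y) - (f (x + k) - f x)| ≤ C * |k| * |y - x| := by
  have hderiv (z : ℝ) :
      HasDerivAt (fun z => f (z + k) - f z) (deriv f (z + k) - deriv f z) z :=
    ((hd1 (z + k)).hasDerivAt.comp_add_const z k).sub (hd1 z).hasDerivAt
  refine abs_sub_le_of_abs_deriv_le (g := fun z => f (z + k) - f z)
    (fun z => (hderiv z).differentiableAt) (fun z => ?_) x y
  rw [(hderiv z).deriv]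
  simpa using abs_sub_le_of_abs_deriv_le hd2 hC z (z + k)

/-- Let `f : ℝ → ℝ` be twice differentiable with bounded first and second
derivatives. Then for all `φ₁, φ₂, φ₃, φ₄ ∈ ℝ`:
`|f(φ₁) − f(φ₂) − f(φ₃) + f(φ₄)|
  ≤ (sup_x |f''(x)|) |φ₁ − φ₂| |φ₁ − φ₃| + (sup_x |f'(x)|) |φ₁ − φ₂ − φ₃ + φ₄|`. -/
theorem stmt14 (f : ℝ → ℝ)
    (hd1 : ∀ x, DifferentiableAt ℝ f x) (hd2 : ∀ x, DifferentiableAt ℝ (deriv f) x)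
    (hb1 : BddAbove (Set.range fun x => |deriv f x|))
    (hb2 : BddAbove (Set.range fun x => |deriv (deriv f) x|))
    (φ₁ φ₂ φ₃ φ₄ : ℝ) :
    |f φ₁ - f φ₂ - f φ₃ + f φ₄| ≤
      (⨆ x, |deriv (deriv f) x|) * |φ₁ - φ₂| * |φ₁ - φ₃| +
        (⨆ x, |deriv f x|) * |φ₁ - φ₂ - φ₃ + φ₄| := by
  have h2 := abs_second_difference_le hd1 hd2 (le_ciSup hb2) φ₁ φ₂ (φ₃ - φ₁)
  have h1 := abs_sub_le_of_abs_deriv_le hd1 (le_ciSup hb1) (φ₂ + (φ₃ - φ₁)) φ₄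
  rw [add_sub_cancel, abs_sub_comm φ₃, abs_sub_comm φ₂, mul_right_comm] at h2
  rw [show φ₄ - (φ₂ + (φ₃ - φ₁)) = φ₁ - φ₂ - φ₃ + φ₄ by ring] at h1
  calc |f φ₁ - f φ₂ - f φ₃ + f φ₄|
      = |(f (φ₂ + (φ₃ - φ₁)) - f φ₂ - (f φ₃ - f φ₁)) + (f φ₄ - f (φ₂ + (φ₃ - φ₁)))| := by
        ring_nf
    _ ≤ _ := (abs_add_le _ _).trans (add_le_add h2 h1)
end

section
/- Let p ∈ [1, ∞) and γ > 0, and let f be an adapted random field on [0,1] × 𝕋 with sup_{(t,x)} ‖f(t,x)‖_{L_p(Ω)} < ∞ and [f]_{𝒱_p^γ[0,1]} < ∞. Then for all 0 ≤ S ≤ Q ≤ T ≤ 1 one has [f]_{𝒱_p^γ[S,T]} ≤ 2 [f]_{𝒱_p^γ[S,Q]} + 2 [f]_{𝒱_p^γ[Q,T]}. Consequently, for every integer K ≥ 2, [f]_{𝒱_p^γ[0,1]} ≤ 2^K ∑_{i=0}^{K−1} [f]_{𝒱_p^γ[i/K, (i+1)/K]}. -/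
open MeasureTheory Real Set ENNReal

noncomputable section

/-- The conditional `L_{p,∞}^𝒢`-norm of a random variable `X`:
`‖X‖_{L_{p,∞}^𝒢} = ess sup_ω (E[|X|^p | 𝒢])^{1/p}`, valued in `ℝ≥0∞`. -/
def condLpInf {Ω : Type*} {m0 : MeasurableSpace Ω} (μ : Measure Ω) (G : MeasurableSpace Ω)
    (p : ℝ) (X : Ω → ℝ) : ℝ≥0∞ :=
  eLpNorm (fun ω => (μ[fun ω' => |X ω'| ^ p|G]) ω ^ (1 / p)) ∞ μ

/-- The bracket `[f]_{𝒱_p^γ[S,T]}` of a random field `f : [0,1] × 𝕋 × Ω → ℝ`: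
`sup_{x ∈ 𝕋} sup_{S ≤ s < t ≤ T} (t−s)^{−γ} ‖f(t,x) − P_{t−s} f(s,·)(x)‖_{L_{p,∞}^{ℱ_s}}`,
where `P_{t−s} f(s,·)(x)(ω) = ∫_𝕋 p_{t−s}(x,y) f(s,y,ω) dy`. Valued in `ℝ≥0∞`. -/
def Vbracket {Ω : Type*} {m0 : MeasurableSpace Ω} (μ : Measure Ω) (ℱ : Filtration ℝ m0)
    (p γ S T : ℝ) (f : ℝ → UnitAddCircle → Ω → ℝ) : ℝ≥0∞ :=
  ⨆ (x : UnitAddCircle) (s : ℝ) (t : ℝ) (_ : S ≤ s) (_ : s < t) (_ : t ≤ T),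
    ENNReal.ofReal ((t - s) ^ (-γ)) *
      condLpInf μ (ℱ s) p (fun ω => f t x ω - ∫ y, heatKer (t - s) x y * f s y ω)

lemma ofReal_gaussKer {t : ℝ} (ht : 0 < t) (z : ℝ) :
    ENNReal.ofReal (gaussKer t z) =
      ProbabilityTheory.gaussianPDF 0 (2 * t).toNNReal z := by
  rw [ProbabilityTheory.gaussianPDF, ProbabilityTheory.gaussianPDFReal, gaussKer,
    Real.coe_toNNReal _ (by positivity)]
  congr 2
  · rw [Real.sqrt_eq_rpow, ← Real.rpow_neg (by positivity)]
    congr 1 <;> ring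
  · congr 2 <;> ring

lemma measurable_gaussKer (t : ℝ) : Measurable (gaussKer t) := by
  unfold gaussKer; fun_prop

/-- The `ℝ≥0∞`-valued periodization of the Gaussian kernel. -/
def perDens (t a : ℝ) : ℝ≥0∞ := ∑' k : ℤ, ENNReal.ofReal (gaussKer t (a + (k : ℝ)))

lemma perKer_eq_toReal {t : ℝ} (ht : 0 < t) (a : ℝ) : perKer t a = (perDens t a).toReal := by
  rw [perDens, ENNReal.tsum_toReal_eq fun _ => ENNReal.ofReal_ne_top, perKer]
  exact tsum_congr fun k => (ENNReal.toReal_ofReal (gaussKer_nonneg ht _)).symm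

lemma measurable_perDens (t : ℝ) : Measurable (perDens t) :=
  Measurable.tsum fun k => ((measurable_gaussKer t).comp (by fun_prop)).ennreal_ofReal

lemma measurable_heatKer_zero {t : ℝ} (ht : 0 < t) :
    Measurable fun y : UnitAddCircle => AddCircle.liftIco 1 0 (perKer t) y := by
  have h : perKer t = fun a => (perDens t a).toReal := funext (perKer_eq_toReal ht)
  rw [h]
  exact ((measurable_perDens t).ennreal_toReal.comp measurable_subtype_coe).comp
    (AddCircle.measurableEquivIco 1 0).measurable

/-- Unfolding a Lebesgue integral over the line into a sum over unit intervals. -/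
lemma lintegral_eq_setLIntegral_tsum_add_int {h : ℝ → ℝ≥0∞} (hh : Measurable h) :
    ∫⁻ z, h z = ∫⁻ z in Ioc (0 : ℝ) 1, ∑' k : ℤ, h (z + k) := by
  have hk : ∀ k : ℤ, AEMeasurable (fun z : ℝ => h (z + k)) (volume.restrict (Ioc 0 1)) :=
    fun k => (hh.comp (measurable_add_const _)).aemeasurable
  rw [lintegral_tsum hk, ← setLIntegral_univ,
    ← iUnion_Ioc_add_intCast (0 : ℝ),
    lintegral_iUnion (fun _ => measurableSet_Ioc) (pairwise_disjoint_Ioc_add_intCast (0 : ℝ))]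
  refine tsum_congr fun k => ?_
  rw [← (measurePreserving_add_right volume (k : ℝ)).setLIntegral_comp_preimage_emb
    (measurableEmbedding_addRight _)]
  simp

/-- The law at time `t` of the heat flow on the circle started at `0`. -/
def heatMeas (t : ℝ) : Measure UnitAddCircle :=
  (ProbabilityTheory.gaussianReal 0 (2 * t).toNNReal).map ((↑) : ℝ → UnitAddCircle)

instance (t : ℝ) : IsProbabilityMeasure (heatMeas t) :=
  Measure.isProbabilityMeasure_map AddCircle.measurable_mk'.aemeasurable

lemma heatMeas_conv {a b : ℝ} (ha : 0 ≤ a) (hb : 0 ≤ b) :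
    heatMeas a ∗ heatMeas b = heatMeas (a + b) := by
  have h := Measure.map_conv_addMonoidHom
    (μ := ProbabilityTheory.gaussianReal 0 (2 * a).toNNReal)
    (ν := ProbabilityTheory.gaussianReal 0 (2 * b).toNNReal)
    (QuotientAddGroup.mk' (AddSubgroup.zmultiples (1 : ℝ))) AddCircle.measurable_mk'
  rw [ProbabilityTheory.gaussianReal_conv_gaussianReal, add_zero,
    ← Real.toNNReal_add (by positivity) (by positivity), ← mul_add] at h
  exact h.symm

lemma heatMeas_eq_withDensity {t : ℝ} (ht : 0 < t) :
    heatMeas t = volume.withDensity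
      fun y => ENNReal.ofReal (AddCircle.liftIco 1 0 (perKer t) y) := by
  have hv : (2 * t).toNNReal ≠ 0 := by
    rw [ne_eq, Real.toNNReal_eq_zero]; linarith
  have hae : ∀ᵐ z ∂(volume.restrict (Ioc (0 : ℝ) 1)), perDens t z < ∞ := by
    refine ae_lt_top (measurable_perDens t) ?_
    have h1 := lintegral_eq_setLIntegral_tsum_add_int (measurable_gaussKer t).ennreal_ofReal
    simp_rw [ofReal_gaussKer ht] at h1
    rw [ProbabilityTheory.lintegral_gaussianPDF_eq_one 0 hv] at h1
    unfold perDens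
    simp_rw [ofReal_gaussKer ht]
    rw [← h1]
    exact ENNReal.one_ne_top
  have hne : ∀ᵐ z ∂(volume.restrict (Ioc (0 : ℝ) 1)), z ≠ 1 :=
    ae_restrict_of_ae (Measure.ae_ne volume 1)
  ext A hA
  have hA' : MeasurableSet (((↑) : ℝ → UnitAddCircle) ⁻¹' A) := AddCircle.measurable_mk' hA
  have hd := ((measurable_heatKer_zero ht).ennreal_ofReal).indicator hA
  rw [withDensity_apply _ hA, ← lintegral_indicator hA, ← UnitAddCircle.lintegral_preimage 0,
    heatMeas, Measure.map_apply AddCircle.measurable_mk' hA,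
    ProbabilityTheory.gaussianReal_apply 0 hv, ← lintegral_indicator hA',
    lintegral_eq_setLIntegral_tsum_add_int
      ((ProbabilityTheory.measurable_gaussianPDF _ _).indicator hA'), zero_add]
  refine lintegral_congr_ae ?_
  filter_upwards [hae, hne, ae_restrict_mem measurableSet_Ioc] with z hz hz1 hzm
  have hper : ∀ k : ℤ, ((z + k : ℝ) : UnitAddCircle) = (z : UnitAddCircle) := fun k => by
    rw [AddCircle.coe_add, add_eq_left, AddCircle.coe_eq_zero_iff]
    exact ⟨k, by simp⟩
  by_cases hzA : (z : UnitAddCircle) ∈ A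
  · rw [indicator_of_mem hzA, AddCircle.liftIco_coe_apply
        ⟨hzm.1.le, lt_of_le_of_ne (by simpa using hzm.2) (by simpa using hz1)⟩,
      perKer_eq_toReal ht, ENNReal.ofReal_toReal hz.ne, perDens]
    refine tsum_congr fun k => ?_
    rw [indicator_of_mem (by simpa only [mem_preimage, hper] using hzA), ofReal_gaussKer ht]
  · rw [indicator_of_notMem hzA, ENNReal.tsum_eq_zero]
    intro k
    exact indicator_of_notMem (by simpa only [mem_preimage, hper] using hzA) _

lemma liftIco_perKer_nonneg {t : ℝ} (ht : 0 < t) (y : UnitAddCircle) :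
    0 ≤ AddCircle.liftIco 1 0 (perKer t) y := by
  have h : perKer t = fun a => (perDens t a).toReal := funext (perKer_eq_toReal ht)
  rw [h]
  exact ENNReal.toReal_nonneg

lemma integral_heatKer_mul {t : ℝ} (ht : 0 < t) (x : UnitAddCircle) (g : UnitAddCircle → ℝ) :
    ∫ y, heatKer t x y * g y = ∫ w, g (x - w) ∂(heatMeas t) := by
  rw [heatMeas_eq_withDensity ht, integral_withDensity_eq_integral_toReal_smul
    (measurable_heatKer_zero ht).ennreal_ofReal (by simp),
    ← integral_sub_left_eq_self _ _ x]
  refine integral_congr_ae (.of_forall fun y => ?_)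
  simp [heatKer, ENNReal.toReal_ofReal (liftIco_perKer_nonneg ht _)]

section CondLp

variable {Ω : Type*} {G m0 : MeasurableSpace Ω} {μ : Measure Ω} {p : ℝ}

lemma eLpNorm_rpow_eq_lintegral (hp : 1 ≤ p) (X : Ω → ℝ) (ν : Measure Ω) :
    eLpNorm X (ENNReal.ofReal p) ν ^ p = ∫⁻ ω, ‖X ω‖ₑ ^ p ∂ν := by
  have hp0 : 0 < p := by linarith
  rw [eLpNorm_eq_lintegral_rpow_enorm_toReal (by simpa using hp0) ENNReal.ofReal_ne_top,
    ENNReal.toReal_ofReal hp0.le, ← ENNReal.rpow_mul, one_div_mul_cancel hp0.ne',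
    ENNReal.rpow_one]

lemma eLpNorm_le_iff_lintegral (hp : 1 ≤ p) (X : Ω → ℝ) (ν : Measure Ω) (C : ℝ≥0∞) :
    eLpNorm X (ENNReal.ofReal p) ν ≤ C ↔ ∫⁻ ω, ‖X ω‖ₑ ^ p ∂ν ≤ C ^ p := by
  rw [← eLpNorm_rpow_eq_lintegral hp, ENNReal.rpow_le_rpow_iff (by linarith)]

lemma lintegral_enorm_rpow_eq_ofReal {X : Ω → ℝ} {ν : Measure Ω} (hp : 1 ≤ p)
    (hX : Integrable (fun ω => |X ω| ^ p) ν) :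
    ∫⁻ ω, ‖X ω‖ₑ ^ p ∂ν = ENNReal.ofReal (∫ ω, |X ω| ^ p ∂ν) := by
  rw [ofReal_integral_eq_lintegral_ofReal hX (.of_forall fun ω => by positivity)]
  refine lintegral_congr fun ω => ?_
  rw [← ENNReal.ofReal_rpow_of_nonneg (abs_nonneg _) (by linarith), Real.enorm_eq_ofReal_abs]

lemma integrable_abs_rpow (hp : 1 ≤ p) {X : Ω → ℝ} (hX : MemLp X (ENNReal.ofReal p) μ) :
    Integrable (fun ω => |X ω| ^ p) μ := by
  have hp0 : 0 < p := by linarith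
  have := hX.integrable_norm_rpow (by simpa using hp0) ENNReal.ofReal_ne_top
  simpa [ENNReal.toReal_ofReal hp0.le] using this

/-- A bound on the conditional norm bounds the `L_p` norm on every event of the
sub-σ-algebra. -/
lemma lintegral_le_of_condLpInf_le [IsProbabilityMeasure μ] (hG : G ≤ m0) (hp : 1 ≤ p)
    {X : Ω → ℝ} (hX : MemLp X (ENNReal.ofReal p) μ) {C : NNReal} (hC : condLpInf μ G p X ≤ C)
    {A : Set Ω} (hA : MeasurableSet[G] A) :
    ∫⁻ ω in A, ‖X ω‖ₑ ^ p ∂μ ≤ (C : ℝ≥0∞) ^ p * μ A := by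
  have hp0 : 0 < p := by linarith
  have hint := integrable_abs_rpow hp hX
  have h0 : 0 ≤ᵐ[μ] μ[fun ω' => |X ω'| ^ p|G] :=
    condExp_nonneg (.of_forall fun ω => by positivity)
  have hle : ∀ᵐ ω ∂μ, (μ[fun ω' => |X ω'| ^ p|G]) ω ≤ (C : ℝ) ^ p := by
    rw [condLpInf, eLpNorm_exponent_top] at hC
    filter_upwards [h0, enorm_ae_le_eLpNormEssSup
      (fun ω => (μ[fun ω' => |X ω'| ^ p|G]) ω ^ (1 / p)) μ] with ω hω hω'
    have h1 := hω'.trans hC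
    rw [Real.enorm_eq_ofReal (Real.rpow_nonneg hω _), ENNReal.ofReal_le_coe] at h1
    calc _ = ((μ[fun ω' => |X ω'| ^ p|G]) ω ^ (1 / p)) ^ p := by
            rw [← Real.rpow_mul hω, one_div_mul_cancel hp0.ne', Real.rpow_one]
      _ ≤ _ := Real.rpow_le_rpow (Real.rpow_nonneg hω _) h1 hp0.le
  rw [lintegral_enorm_rpow_eq_ofReal hp hint.restrict, ← setIntegral_condExp hG hint hA]
  have h3 : ∫ ω in A, (μ[fun ω' => |X ω'| ^ p|G]) ω ∂μ ≤ ∫ _ω in A, (C : ℝ) ^ p ∂μ :=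
    integral_mono_ae integrable_condExp.restrict (integrable_const _) (ae_restrict_of_ae hle)
  refine (ENNReal.ofReal_le_ofReal h3).trans ?_
  rw [setIntegral_const, smul_eq_mul, mul_comm, ENNReal.ofReal_mul (by positivity),
    ← ENNReal.ofReal_rpow_of_nonneg C.coe_nonneg hp0.le]
  simp [Measure.real]

/-- Bounds on the `L_p` norm on all events of the sub-σ-algebra bound the conditional norm. -/
lemma condLpInf_le_of_lintegral_le [IsProbabilityMeasure μ] (hG : G ≤ m0) (hp : 1 ≤ p)
    {X : Ω → ℝ} {C : NNReal}
    (hC : ∀ A, MeasurableSet[G] A → ∫⁻ ω in A, ‖X ω‖ₑ ^ p ∂μ ≤ (C : ℝ≥0∞) ^ p * μ A) :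
    condLpInf μ G p X ≤ C := by
  have hp0 : 0 < p := by linarith
  by_cases hint : Integrable (fun ω => |X ω| ^ p) μ
  swap
  · have h0 : (fun ω => (μ[fun ω' => |X ω'| ^ p|G]) ω ^ (1 / p)) = 0 := by
      ext ω
      simp [condExp_of_not_integrable hint, Real.zero_rpow (inv_pos.2 hp0).ne']
    rw [condLpInf, h0, eLpNorm_zero]
    exact zero_le
  have h0 : 0 ≤ᵐ[μ] μ[fun ω' => |X ω'| ^ p|G] :=
    condExp_nonneg (.of_forall fun ω => by positivity)
  have hle : ∀ᵐ ω ∂μ, (μ[fun ω' => |X ω'| ^ p|G]) ω ≤ (C : ℝ) ^ p := by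
    refine ae_le_of_ae_le_trim (hm := hG) (f₂ := fun _ => (C : ℝ) ^ p) ?_
    refine ae_le_of_forall_setIntegral_le
      (integrable_condExp.trim hG stronglyMeasurable_condExp) (integrable_const _) fun A hA _ => ?_
    rw [← setIntegral_trim hG stronglyMeasurable_condExp hA,
      ← setIntegral_trim hG stronglyMeasurable_const hA, setIntegral_condExp hG hint hA,
      setIntegral_const, smul_eq_mul]
    have h := hC A hA
    rw [lintegral_enorm_rpow_eq_ofReal hp hint.restrict] at h
    have h' := ENNReal.ofReal_le_iff_le_toReal
      (ENNReal.mul_ne_top (ENNReal.rpow_ne_top_of_nonneg hp0.le ENNReal.coe_ne_top)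
        (measure_ne_top _ _)) |>.1 h
    rwa [ENNReal.toReal_mul, ← ENNReal.toReal_rpow, ENNReal.coe_toReal, mul_comm] at h'
  rw [condLpInf, eLpNorm_exponent_top]
  refine eLpNormEssSup_le_of_ae_enorm_bound ?_
  filter_upwards [h0, hle] with ω h1 h2
  rw [Real.enorm_eq_ofReal (Real.rpow_nonneg h1 _), ENNReal.ofReal_le_coe]
  calc _ ≤ ((C : ℝ) ^ p) ^ (1 / p) := Real.rpow_le_rpow h1 h2 (by positivity)
    _ = C := by rw [← Real.rpow_mul C.coe_nonneg, mul_one_div_cancel hp0.ne', Real.rpow_one]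

lemma lintegral_lintegral_enorm_rpow_le {W : Type*} [MeasurableSpace W] [SFinite μ]
    {ν : Measure W} [IsProbabilityMeasure ν] {h : W → Ω → ℝ} (hh : Measurable (Function.uncurry h))
    {C : ℝ≥0∞} (hC : ∀ w, ∫⁻ ω, ‖h w ω‖ₑ ^ p ∂μ ≤ C) :
    ∫⁻ ω, ∫⁻ w, ‖h w ω‖ₑ ^ p ∂ν ∂μ ≤ C := by
  have hm : Measurable (Function.uncurry fun ω w => ‖h w ω‖ₑ ^ p) :=
    (hh.comp measurable_swap).enorm.pow_const p
  rw [lintegral_lintegral_swap hm.aemeasurable]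
  exact (lintegral_mono hC).trans (by simp)

/-- Jensen's inequality for averages of random variables. -/
lemma lintegral_enorm_integral_rpow_le {W : Type*} [MeasurableSpace W] [SFinite μ]
    {ν : Measure W} [IsProbabilityMeasure ν] (hp : 1 ≤ p)
    {h : W → Ω → ℝ} (hh : Measurable (Function.uncurry h))
    {C : ℝ≥0∞} (hC : ∀ w, ∫⁻ ω, ‖h w ω‖ₑ ^ p ∂μ ≤ C) :
    ∫⁻ ω, ‖∫ w, h w ω ∂ν‖ₑ ^ p ∂μ ≤ C := by
  refine (lintegral_mono fun ω => ?_).trans (lintegral_lintegral_enorm_rpow_le (ν := ν) hh hC)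
  have hm : Measurable fun w => h w ω := hh.comp measurable_prodMk_right
  rw [← eLpNorm_rpow_eq_lintegral hp]
  refine ENNReal.rpow_le_rpow ?_ (by linarith)
  refine (enorm_integral_le_lintegral_enorm _).trans ?_
  rw [← eLpNorm_one_eq_lintegral_enorm]
  exact eLpNorm_le_eLpNorm_of_exponent_le (by simpa using hp) hm.aestronglyMeasurable

lemma ae_integrable_of_lintegral_rpow_le {W : Type*} [MeasurableSpace W] [SFinite μ]
    {ν : Measure W} [IsProbabilityMeasure ν] (hp : 1 ≤ p)
    {h : W → Ω → ℝ} (hh : Measurable (Function.uncurry h))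
    {C : ℝ≥0∞} (hCt : C < ∞) (hC : ∀ w, ∫⁻ ω, ‖h w ω‖ₑ ^ p ∂μ ≤ C) :
    ∀ᵐ ω ∂μ, Integrable (fun w => h w ω) ν := by
  have hp0 : 0 < p := by linarith
  have hmeas : Measurable fun ω => ∫⁻ w, ‖h w ω‖ₑ ^ p ∂ν :=
    Measurable.lintegral_prod_right' (f := fun z : Ω × W => ‖h z.2 z.1‖ₑ ^ p)
      ((hh.comp measurable_swap).enorm.pow_const p)
  filter_upwards [ae_lt_top hmeas
    ((lintegral_lintegral_enorm_rpow_le (ν := ν) hh hC).trans_lt hCt).ne] with ω hω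
  have hm : Measurable fun w => h w ω := hh.comp measurable_prodMk_right
  have hL : MemLp (fun w => h w ω) (ENNReal.ofReal p) ν := by
    refine ⟨hm.aestronglyMeasurable, ?_⟩
    rw [← eLpNorm_rpow_eq_lintegral hp] at hω
    exact (ENNReal.rpow_lt_top_iff_of_pos hp0).1 hω
  exact hL.integrable (by simpa using hp)

end CondLp

section Triangle

variable {Ω : Type*} {G H m0 : MeasurableSpace Ω} {μ : Measure Ω} {p : ℝ}

lemma measurable_uncurry_comp_sub {F : UnitAddCircle → Ω → ℝ}
    (hF : Measurable (Function.uncurry F)) (x : UnitAddCircle) :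
    Measurable (Function.uncurry fun w => F (x - w)) :=
  hF.comp ((measurable_const.sub measurable_fst).prodMk measurable_snd)

lemma measurable_uncurry_integral_heatMeas {F : UnitAddCircle → Ω → ℝ}
    (hF : Measurable (Function.uncurry F)) (b : ℝ) :
    Measurable (Function.uncurry fun y ω => ∫ w, F (y - w) ω ∂(heatMeas b)) := by
  have h : Measurable fun z : (UnitAddCircle × Ω) × UnitAddCircle => F (z.1.1 - z.2) z.1.2 :=
    hF.comp (((measurable_fst.comp measurable_fst).sub measurable_snd).prodMk
      (measurable_snd.comp measurable_fst))
  exact (h.stronglyMeasurable.integral_prod_right' (ν := heatMeas b)).measurable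

/-- The semigroup property for the action of the heat semigroup on functions. -/
lemma integral_heatMeas_heatMeas {a b : ℝ} (ha : 0 ≤ a) (hb : 0 ≤ b) {g : UnitAddCircle → ℝ}
    {x : UnitAddCircle} (hg : Integrable (fun v => g (x - v)) (heatMeas (a + b))) :
    Integrable (fun w => ∫ w', g (x - w - w') ∂(heatMeas b)) (heatMeas a) ∧
    ∫ w, ∫ w', g (x - w - w') ∂(heatMeas b) ∂(heatMeas a) = ∫ v, g (x - v) ∂(heatMeas (a + b)) := by
  rw [← heatMeas_conv ha hb] at hg ⊢
  simp_rw [sub_sub]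
  refine ⟨?_, (integral_conv hg).symm⟩
  have h := (integrable_conv_iff hg.1).1 hg
  refine h.2.mono ?_ (.of_forall fun w => ?_)
  · have h1 := hg.1
    rw [Measure.conv] at h1
    exact (h1.comp_measurable (by fun_prop)).integral_prod_right'
  · rw [Real.norm_of_nonneg (integral_nonneg fun _ => norm_nonneg _)]
    exact norm_integral_le_integral_norm _

lemma condLpInf_heat_triangle [IsProbabilityMeasure μ] (hGH : G ≤ H) (hH : H ≤ m0) (hp : 1 ≤ p)
    {F₀ F₁ F₂ : UnitAddCircle → Ω → ℝ} (hF₀ : Measurable (Function.uncurry F₀))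
    (hF₁ : Measurable (Function.uncurry F₁)) (hF₂ : Measurable (Function.uncurry F₂))
    {M : ℝ≥0∞} (hM : M < ∞) (hM₀ : ∀ x, eLpNorm (F₀ x) (ENNReal.ofReal p) μ ≤ M)
    (hM₁ : ∀ x, eLpNorm (F₁ x) (ENNReal.ofReal p) μ ≤ M)
    (hM₂ : ∀ x, eLpNorm (F₂ x) (ENNReal.ofReal p) μ ≤ M)
    {a b : ℝ} (ha : 0 < a) (hb : 0 < b) {C₁ C₂ : NNReal} (x : UnitAddCircle)
    (h₁ : condLpInf μ H p (fun ω => F₂ x ω - ∫ y, heatKer a x y * F₁ y ω) ≤ C₁)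
    (h₂ : ∀ y, condLpInf μ G p (fun ω => F₁ y ω - ∫ z, heatKer b y z * F₀ z ω) ≤ C₂) :
    condLpInf μ G p (fun ω => F₂ x ω - ∫ y, heatKer (a + b) x y * F₀ y ω) ≤
      ((C₁ + C₂ : NNReal) : ℝ≥0∞) := by
  have hp0 : 0 < p := by linarith
  have hq : 1 ≤ ENNReal.ofReal p := by simpa using hp
  have hMp : M ^ p < ∞ := ENNReal.rpow_lt_top_of_nonneg hp0.le hM.ne
  have hsec : ∀ {F : UnitAddCircle → Ω → ℝ}, Measurable (Function.uncurry F) →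
      ∀ y, Measurable (F y) := fun hF y => hF.comp measurable_prodMk_left
  have hsub : ∀ {F F' : UnitAddCircle → Ω → ℝ} {b : ℝ}, Measurable (Function.uncurry F) →
      Measurable (Function.uncurry F') → (∀ x, eLpNorm (F x) (ENNReal.ofReal p) μ ≤ M) →
      (∀ x, eLpNorm (F' x) (ENNReal.ofReal p) μ ≤ M) → ∀ y,
      MemLp (fun ω => F y ω - ∫ w, F' (y - w) ω ∂(heatMeas b)) (ENNReal.ofReal p) μ := by
    intro F F' b hF hF' hB hB' y
    refine MemLp.sub ⟨(hsec hF y).aestronglyMeasurable, (hB y).trans_lt hM⟩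
      ⟨(hsec (measurable_uncurry_integral_heatMeas hF' b) y).aestronglyMeasurable,
        ((eLpNorm_le_iff_lintegral hp _ _ _).2 ?_).trans_lt hM⟩
    exact lintegral_enorm_integral_rpow_le hp (measurable_uncurry_comp_sub hF' y)
      fun w => (eLpNorm_le_iff_lintegral hp _ _ _).1 (hB' _)
  simp_rw [integral_heatKer_mul ha] at h₁
  simp_rw [integral_heatKer_mul hb] at h₂
  simp_rw [integral_heatKer_mul (add_pos ha hb)]
  set g : UnitAddCircle → Ω → ℝ := fun y ω => F₁ y ω - ∫ w, F₀ (y - w) ω ∂(heatMeas b) with hg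
  have hgm : Measurable (Function.uncurry g) :=
    hF₁.sub (measurable_uncurry_integral_heatMeas hF₀ b)
  have hi₁ : ∀ᵐ ω ∂μ, Integrable (fun w => F₁ (x - w) ω) (heatMeas a) :=
    ae_integrable_of_lintegral_rpow_le hp (measurable_uncurry_comp_sub hF₁ x) hMp
      fun w => (eLpNorm_le_iff_lintegral hp _ _ _).1 (hM₁ _)
  have hi₀ : ∀ᵐ ω ∂μ, Integrable (fun w => F₀ (x - w) ω) (heatMeas (a + b)) :=
    ae_integrable_of_lintegral_rpow_le hp (measurable_uncurry_comp_sub hF₀ x) hMp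
      fun w => (eLpNorm_le_iff_lintegral hp _ _ _).1 (hM₀ _)
  set D₁ : Ω → ℝ := fun ω => F₂ x ω - ∫ w, F₁ (x - w) ω ∂(heatMeas a) with hD₁
  set D₂ : Ω → ℝ := fun ω => ∫ w, g (x - w) ω ∂(heatMeas a) with hD₂
  have hdec : (fun ω => F₂ x ω - ∫ w, F₀ (x - w) ω ∂(heatMeas (a + b))) =ᵐ[μ] D₁ + D₂ := by
    filter_upwards [hi₁, hi₀] with ω h1 h0
    obtain ⟨h3, h4⟩ := integral_heatMeas_heatMeas (g := fun y => F₀ y ω) ha.le hb.le h0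
    simp only [Pi.add_apply, hD₁, hD₂, hg]
    rw [integral_sub h1 h3, h4]
    ring
  refine condLpInf_le_of_lintegral_le (hGH.trans hH) hp fun A hA => ?_
  have key : ∀ {X : Ω → ℝ} {C : NNReal},
      ∫⁻ ω in A, ‖X ω‖ₑ ^ p ∂μ ≤ (C : ℝ≥0∞) ^ p * μ A ↔
        eLpNorm X (ENNReal.ofReal p) (μ.restrict A) ≤ C * μ A ^ (1 / p) := by
    intro X C
    rw [eLpNorm_le_iff_lintegral hp, ENNReal.mul_rpow_of_nonneg _ _ hp0.le, ← ENNReal.rpow_mul,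
      one_div_mul_cancel hp0.ne', ENNReal.rpow_one]
  have e₁ := key.1 (lintegral_le_of_condLpInf_le hH hp (hsub hF₂ hF₁ hM₂ hM₁ x) h₁ (hGH A hA))
  have e₂ : eLpNorm D₂ (ENNReal.ofReal p) (μ.restrict A) ≤ C₂ * μ A ^ (1 / p) :=
    key.1 (lintegral_enorm_integral_rpow_le hp (measurable_uncurry_comp_sub hgm x) fun w =>
      lintegral_le_of_condLpInf_le (hGH.trans hH) hp (hsub hF₁ hF₀ hM₁ hM₀ _) (h₂ _) hA)
  rw [key, eLpNorm_congr_ae (ae_restrict_of_ae hdec), ENNReal.coe_add, add_mul]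
  exact (eLpNorm_add_le (hsub hF₂ hF₁ hM₂ hM₁ x).1.restrict
    (hsec (measurable_uncurry_integral_heatMeas hgm a) x).aestronglyMeasurable hq).trans
    (add_le_add e₁ e₂)

lemma condLpInf_le_Vbracket {ℱ : Filtration ℝ m0} {γ S T : ℝ} {f : ℝ → UnitAddCircle → Ω → ℝ}
    {s t : ℝ} (hS : S ≤ s) (hst : s < t) (hT : t ≤ T) (x : UnitAddCircle) :
    condLpInf μ (ℱ s) p (fun ω => f t x ω - ∫ y, heatKer (t - s) x y * f s y ω) ≤
      ENNReal.ofReal ((t - s) ^ γ) * Vbracket μ ℱ p γ S T f := by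
  have h0 : 0 < t - s := sub_pos.2 hst
  have h : ENNReal.ofReal ((t - s) ^ (-γ)) *
      condLpInf μ (ℱ s) p (fun ω => f t x ω - ∫ y, heatKer (t - s) x y * f s y ω) ≤
      Vbracket μ ℱ p γ S T f :=
    le_iSup_of_le x <| le_iSup_of_le s <| le_iSup_of_le t <| le_iSup_of_le hS <|
      le_iSup_of_le hst <| le_iSup_of_le hT le_rfl
  refine le_trans (le_of_eq ?_) (mul_le_mul_right h _)
  rw [← mul_assoc, ← ENNReal.ofReal_mul (by positivity), ← Real.rpow_add h0]
  simp

lemma Vbracket_le_iff {ℱ : Filtration ℝ m0} {γ S T : ℝ} {f : ℝ → UnitAddCircle → Ω → ℝ}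
    {V : ℝ≥0∞} :
    Vbracket μ ℱ p γ S T f ≤ V ↔ ∀ x s t, S ≤ s → s < t → t ≤ T →
      ENNReal.ofReal ((t - s) ^ (-γ)) *
        condLpInf μ (ℱ s) p (fun ω => f t x ω - ∫ y, heatKer (t - s) x y * f s y ω) ≤ V := by
  simp only [Vbracket, iSup_le_iff]

lemma Vbracket_self {ℱ : Filtration ℝ m0} {γ S : ℝ} {f : ℝ → UnitAddCircle → Ω → ℝ} :
    Vbracket μ ℱ p γ S S f = 0 :=
  le_antisymm (Vbracket_le_iff.2 fun _ _ _ h1 h2 h3 => absurd (h1.trans_lt h2) h3.not_gt) bot_le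

/-- The bracket is subadditive over adjacent time intervals. -/
lemma Vbracket_le_add [IsProbabilityMeasure μ] {ℱ : Filtration ℝ m0} {γ : ℝ} (hp : 1 ≤ p)
    (hγ : 0 ≤ γ) {f : ℝ → UnitAddCircle → Ω → ℝ}
    (hjm : Measurable fun q : ℝ × UnitAddCircle × Ω => f q.1 q.2.1 q.2.2)
    {M : ℝ≥0∞} (hM : M < ∞) (hf : ∀ t x, eLpNorm (f t x) (ENNReal.ofReal p) μ ≤ M)
    (S Q T : ℝ) :
    Vbracket μ ℱ p γ S T f ≤ Vbracket μ ℱ p γ S Q f + Vbracket μ ℱ p γ Q T f := by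
  rcases eq_or_ne (Vbracket μ ℱ p γ S Q f + Vbracket μ ℱ p γ Q T f) ∞ with hV | hV
  · exact hV ▸ le_top
  obtain ⟨hV₁, hV₂⟩ := ENNReal.add_ne_top.1 hV
  have hsec : ∀ r, Measurable (Function.uncurry (f r)) := fun r => hjm.comp measurable_prodMk_left
  refine Vbracket_le_iff.2 fun x s t hs hst ht => ?_
  rcases le_or_gt t Q with htQ | htQ
  · exact (Vbracket_le_iff.1 le_rfl x s t hs hst htQ).trans le_self_add
  rcases le_or_gt Q s with hQs | hQs
  · exact (Vbracket_le_iff.1 le_rfl x s t hQs hst ht).trans le_add_self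
  have hst0 : 0 < t - s := sub_pos.2 hst
  lift Vbracket μ ℱ p γ S Q f to NNReal using hV₁ with V₁ hVeq₁
  lift Vbracket μ ℱ p γ Q T f to NNReal using hV₂ with V₂ hVeq₂
  have h₁ : condLpInf μ (ℱ Q) p (fun ω => f t x ω - ∫ y, heatKer (t - Q) x y * f Q y ω) ≤
      (((t - s) ^ γ).toNNReal * V₂ : NNReal) := by
    refine (condLpInf_le_Vbracket (γ := γ) le_rfl htQ ht x).trans ?_
    rw [← hVeq₂, ENNReal.coe_mul]
    gcongr
    exact ENNReal.ofReal_le_ofReal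
      (Real.rpow_le_rpow (by linarith) (by linarith) hγ)
  have h₂ : ∀ y, condLpInf μ (ℱ s) p (fun ω => f Q y ω - ∫ z, heatKer (Q - s) y z * f s z ω) ≤
      (((t - s) ^ γ).toNNReal * V₁ : NNReal) := by
    intro y
    refine (condLpInf_le_Vbracket (γ := γ) hs hQs le_rfl y).trans ?_
    rw [← hVeq₁, ENNReal.coe_mul]
    gcongr
    exact ENNReal.ofReal_le_ofReal
      (Real.rpow_le_rpow (by linarith) (by linarith) hγ)
  have h := condLpInf_heat_triangle (ℱ.mono hQs.le) (ℱ.le Q) hp (hsec s) (hsec Q) (hsec t) hM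
    (hf s) (hf Q) (hf t) (sub_pos.2 htQ) (sub_pos.2 hQs) x h₁ h₂
  rw [sub_add_sub_cancel, ← mul_add, ENNReal.coe_mul, ENNReal.coe_add] at h
  refine (mul_le_mul_right h _).trans (le_of_eq ?_)
  change ENNReal.ofReal _ * (ENNReal.ofReal _ * _) = _
  rw [← mul_assoc, ← ENNReal.ofReal_mul (by positivity), ← Real.rpow_add hst0, neg_add_cancel,
    Real.rpow_zero, ENNReal.ofReal_one, one_mul, add_comm]

end Triangle

/-- the `𝒱_p^γ`-bracket is triangular in time. Let `p ∈ [1,∞)`, `γ > 0`,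
and let `f` be an adapted random field on `[0,1] × 𝕋` with
`sup_{(t,x)} ‖f(t,x)‖_{L_p} < ∞` and `[f]_{𝒱_p^γ[0,1]} < ∞`. Then for all
`0 ≤ S ≤ Q ≤ T ≤ 1` one has `[f]_{𝒱_p^γ[S,T]} ≤ 2[f]_{𝒱_p^γ[S,Q]} + 2[f]_{𝒱_p^γ[Q,T]}`,
and consequently for every integer `K ≥ 2`,
`[f]_{𝒱_p^γ[0,1]} ≤ 2^K ∑_{i=0}^{K−1} [f]_{𝒱_p^γ[i/K,(i+1)/K]}`. -/
theorem stmt16 {Ω : Type*} {m0 : MeasurableSpace Ω} (μ : Measure Ω) [IsProbabilityMeasure μ]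
    (ℱ : Filtration ℝ m0) (p γ : ℝ) (hp : 1 ≤ p) (hγ : 0 < γ)
    (f : ℝ → UnitAddCircle → Ω → ℝ)
    (hjm : Measurable fun q : ℝ × UnitAddCircle × Ω => f q.1 q.2.1 q.2.2)
    (hadapt : ∀ t x, Measurable[ℱ t] (f t x))
    (hbdd : ∃ M : ℝ≥0∞, M < ∞ ∧ ∀ t x, eLpNorm (f t x) (ENNReal.ofReal p) μ ≤ M)
    (hV : Vbracket μ ℱ p γ 0 1 f < ∞) :
    (∀ S Q T : ℝ, 0 ≤ S → S ≤ Q → Q ≤ T → T ≤ 1 →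
      Vbracket μ ℱ p γ S T f ≤ 2 * Vbracket μ ℱ p γ S Q f + 2 * Vbracket μ ℱ p γ Q T f) ∧
    (∀ K : ℕ, 2 ≤ K →
      Vbracket μ ℱ p γ 0 1 f ≤
        2 ^ K * ∑ i ∈ Finset.range K,
          Vbracket μ ℱ p γ ((i : ℝ) / K) (((i : ℝ) + 1) / K) f) := by
  obtain ⟨M, hM, hf⟩ := hbdd
  have hadd := Vbracket_le_add (μ := μ) (ℱ := ℱ) hp hγ.le hjm hM hf
  refine ⟨fun S Q T _ _ _ _ => ?_, fun K hK => ?_⟩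
  · rw [← mul_add, two_mul]
    exact (hadd S Q T).trans le_self_add
  · have hind : ∀ j : ℕ, Vbracket μ ℱ p γ 0 ((j : ℝ) / K) f ≤
        ∑ i ∈ Finset.range j, Vbracket μ ℱ p γ ((i : ℝ) / K) (((i : ℝ) + 1) / K) f := by
      intro j
      induction j with
      | zero => simp [Vbracket_self]
      | succ j ih =>
        rw [Finset.sum_range_succ, Nat.cast_succ]
        exact (hadd 0 ((j : ℝ) / K) _).trans (add_le_add_left ih _)
    have h := hind K
    rw [div_self (by positivity)] at h
    exact h.trans (le_mul_of_one_le_left' (one_le_pow₀ one_le_two))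
end
end
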